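/- (Lemma 6.1) Let n ≥ 5 and let u be a smooth strictly convex function on a convex domain Ω ⊆ ℝⁿ satisfying equation (1.4), with u ≥ 0, u(p) = 0 at some p ∈ Ω, and let 0 < C ≤ 1 be such that the section S̄_u(p,C) = {ξ ∈ Ω : u(ξ) ≤ C} is a compact subset of Ω. Assume there are constants b₁ ≥ 0 and d > 1 such that |∇u|²/(d+f)² ≤ b₁ and |u+f| ≤ d+f on S̄_u(p,C). Set α = (n+2)(n−3)/2 + (n−1)/4, m = 32(n+2)C, h = m/(C−u)², ε = 1/(30(1+b₁)), and H = ε |∇u|²/(d+f)². Then there is a constant d₁ > 0 depending only on n, b₁ and C such that on S_u(p,C) = {ξ ∈ Ω : u(ξ) < C} one has both exp(−m/(C−u)) · ρ^α Φ/(d+f)^{2nα/(n+2)} ≤ d₁ and exp(−m/(C−u) + H) · (h+2α) ρ^α/(d+f)^{2nα/(n+2)} ≤ d₁. -/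

import Mathlib

noncomputable section

/-- The `i`-th partial derivative of a function on `ℝⁿ`. -/
def pd {n : ℕ} (i : Fin n) (f : (Fin n → ℝ) → ℝ) : (Fin n → ℝ) → ℝ :=
  fun x => fderiv ℝ f x (Pi.single i 1)

/-- The Hessian matrix `(∂²f/∂x_i∂x_j)`. -/
def hess {n : ℕ} (f : (Fin n → ℝ) → ℝ) (x : Fin n → ℝ) : Matrix (Fin n) (Fin n) ℝ :=
  Matrix.of fun i j => pd i (pd j f) x

/-- `ρ = (det D²u)^{1/(n+2)}`. -/
def rhoU {n : ℕ} (u : (Fin n → ℝ) → ℝ) (x : Fin n → ℝ) : ℝ :=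
  (hess u x).det ^ ((1 : ℝ) / (n + 2))

/-- `Φ = ‖∇ρ‖²/ρ²` with respect to the Calabi metric `G = D²u`. -/
def PhiU {n : ℕ} (u : (Fin n → ℝ) → ℝ) (x : Fin n → ℝ) : ℝ :=
  (1 / (rhoU u x) ^ 2) *
    ∑ i : Fin n, ∑ j : Fin n, (hess u x)⁻¹ i j * pd i (rhoU u) x * pd j (rhoU u) x

/-- The Legendre transform function `f(ξ) = ⟨ξ, ∇u(ξ)⟩ − u(ξ)`. -/
def legendreF {n : ℕ} (u : (Fin n → ℝ) → ℝ) (ξ : Fin n → ℝ) : ℝ :=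
  (∑ i : Fin n, ξ i * pd i u ξ) - u ξ

/-- `α = (n+2)(n−3)/2 + (n−1)/4`. -/
def alph (n : ℕ) : ℝ :=
  ((n : ℝ) + 2) * ((n : ℝ) - 3) / 2 + ((n : ℝ) - 1) / 4


open Filter Topology

/-- Two-jet at `0` of a function of one real variable. -/
def Jet (g : ℝ → ℝ) (c p q : ℝ) : Prop :=
  g 0 = c ∧ ∃ g' : ℝ → ℝ, (∀ᶠ s in 𝓝 (0:ℝ), HasDerivAt g (g' s) s) ∧ g' 0 = p ∧
    HasDerivAt g' q 0

lemma Jet.const (c : ℝ) : Jet (fun _ => c) c 0 0 :=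
  ⟨rfl, fun _ => 0, Eventually.of_forall fun s => hasDerivAt_const s c, rfl, hasDerivAt_const _ _⟩

lemma Jet.add {g h : ℝ → ℝ} {c p q c' p' q' : ℝ} (hg : Jet g c p q) (hh : Jet h c' p' q') :
    Jet (fun s => g s + h s) (c + c') (p + p') (q + q') := by
  obtain ⟨h0, g1, hg1, h1, h2⟩ := hg
  obtain ⟨k0, g2, hg2, k1, k2⟩ := hh
  refine ⟨by simp [h0, k0], fun s => g1 s + g2 s, ?_, by simp [h1, k1], h2.add k2⟩
  filter_upwards [hg1, hg2] with s a b using a.add b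

lemma Jet.mul {g h : ℝ → ℝ} {c p q c' p' q' : ℝ} (hg : Jet g c p q) (hh : Jet h c' p' q') :
    Jet (fun s => g s * h s) (c * c') (p * c' + c * p') (q * c' + 2 * p * p' + c * q') := by
  obtain ⟨h0, g1, hg1, h1, h2⟩ := hg
  obtain ⟨k0, g2, hg2, k1, k2⟩ := hh
  refine ⟨by simp [h0, k0], fun s => g1 s * h s + g s * g2 s, ?_, by simp [h0, k0, h1, k1], ?_⟩
  · filter_upwards [hg1, hg2] with s a b using a.mul b
  · have := (h2.mul hg2.self_of_nhds).add (hg1.self_of_nhds.mul k2)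
    refine this.congr_deriv ?_
    rw [h0, h1, k0, k1]; ring

lemma Jet.sum {ι : Type*} (s : Finset ι) {g : ι → ℝ → ℝ} {c p q : ι → ℝ}
    (h : ∀ i ∈ s, Jet (g i) (c i) (p i) (q i)) :
    Jet (fun t => ∑ i ∈ s, g i t) (∑ i ∈ s, c i) (∑ i ∈ s, p i) (∑ i ∈ s, q i) := by
  classical
  induction s using Finset.induction_on with
  | empty => simpa using Jet.const 0
  | insert a s ha ih =>
    simp only [Finset.sum_insert ha]
    exact (h a (Finset.mem_insert_self _ _)).add
      (ih fun i hi => h i (Finset.mem_insert_of_mem hi))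

lemma Jet.smul {g : ℝ → ℝ} {c p q : ℝ} (k : ℝ) (hg : Jet g c p q) :
    Jet (fun s => k * g s) (k * c) (k * p) (k * q) := by
  have := (Jet.const k).mul hg
  simpa using this

/-- Composition with a function with known derivatives. -/
lemma Jet.comp {g : ℝ → ℝ} {c p q : ℝ} (hg : Jet g c p q) (F F' : ℝ → ℝ) (r : ℝ)
    (hF : ∀ᶠ z in 𝓝 c, HasDerivAt F (F' z) z) (hF' : HasDerivAt F' r c) :
    Jet (fun s => F (g s)) (F c) (F' c * p) (r * p ^ 2 + F' c * q) := by
  obtain ⟨h0, g1, hg1, h1, h2⟩ := hg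
  have hg0 := hg1.self_of_nhds
  refine ⟨by simp [h0], fun s => F' (g s) * g1 s, ?_, by simp [h0, h1], ?_⟩
  · have hc : Tendsto g (𝓝 0) (𝓝 c) := by
      have := hg0.continuousAt.tendsto
      rwa [h0] at this
    filter_upwards [hg1, hc.eventually hF] with s a b using b.comp s a
  · have e : HasDerivAt F' r (g 0) := by rw [h0]; exact hF'
    have := (e.comp (0:ℝ) hg0).mul h2
    refine this.congr_deriv ?_
    simp only [Function.comp]
    rw [h0, h1]; ring

lemma Jet.log {g : ℝ → ℝ} {c p q : ℝ} (hg : Jet g c p q) (hc : 0 < c) :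
    Jet (fun s => Real.log (g s)) (Real.log c) (p / c) (q / c - p ^ 2 / c ^ 2) := by
  have := hg.comp Real.log (fun z => z⁻¹) (-(c ^ 2)⁻¹)
    (by filter_upwards [lt_mem_nhds hc] with z hz using Real.hasDerivAt_log hz.ne')
    (hasDerivAt_inv hc.ne')
  convert this using 1 <;> field_simp
  ring

lemma Jet.inv {g : ℝ → ℝ} {c p q : ℝ} (hg : Jet g c p q) (hc : 0 < c) :
    Jet (fun s => (g s)⁻¹) (c⁻¹) (-p / c ^ 2) (2 * p ^ 2 / c ^ 3 - q / c ^ 2) := by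
  have h2 : HasDerivAt (fun z : ℝ => -(z ^ 2)⁻¹) (2 / c ^ 3) c := by
    have := ((hasDerivAt_pow 2 c).inv (by positivity)).neg
    refine this.congr_deriv ?_
    field_simp
    norm_num
    field_simp
  have := hg.comp (fun z => z⁻¹) (fun z => -(z ^ 2)⁻¹) (2 / c ^ 3)
    (by filter_upwards [lt_mem_nhds hc] with z hz using hasDerivAt_inv hz.ne')
    h2
  convert this using 1 <;> field_simp
  ring

/-- Second derivative test. -/
lemma Jet.of_max {g : ℝ → ℝ} {c p q : ℝ} (hg : Jet g c p q) (hm : IsLocalMax g 0) :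
    p = 0 ∧ q ≤ 0 := by
  obtain ⟨h0, g1, hg1, h1, h2⟩ := hg
  have hp : p = 0 := by rw [← h1]; exact hm.hasDerivAt_eq_zero hg1.self_of_nhds
  refine ⟨hp, ?_⟩
  by_contra hq
  push Not at hq
  have e : deriv g =ᶠ[𝓝 0] g1 := by
    filter_upwards [hg1] with s hs using hs.deriv
  have hdd : deriv (deriv g) 0 = q := by rw [e.deriv_eq, h2.deriv]
  have hmin := isLocalMin_of_deriv_deriv_pos (f := g) (x₀ := 0) (by rw [hdd]; exact hq)
    (by rw [e.eq_of_nhds, h1, hp]) hg1.self_of_nhds.continuousAt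
  have hconst : g =ᶠ[𝓝 0] fun _ => g 0 := by
    filter_upwards [hm, hmin] with s a b using le_antisymm a b
  have hd : deriv g =ᶠ[𝓝 0] fun _ => 0 := by
    filter_upwards [hconst.eventuallyEq_nhds] with s hs
    rw [hs.deriv_eq]; simp
  have : deriv (deriv g) 0 = 0 := by rw [hd.deriv_eq]; simp
  linarith

/-- Directional derivative. -/
def dd {n : ℕ} (v : Fin n → ℝ) (f : (Fin n → ℝ) → ℝ) : (Fin n → ℝ) → ℝ :=
  fun x => fderiv ℝ f x v

lemma pd_eq_dd {n : ℕ} (i : Fin n) (f : (Fin n → ℝ) → ℝ) : pd i f = dd (Pi.single i 1) f := rfl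

lemma dd_eq_sum {n : ℕ} (v : Fin n → ℝ) (f : (Fin n → ℝ) → ℝ) (x : Fin n → ℝ) :
    dd v f x = ∑ i, v i * pd i f x := by
  unfold dd pd
  conv_lhs => rw [pi_eq_sum_univ' v]
  simp [map_sum]

lemma smooth_dd {n : ℕ} {Ω : Set (Fin n → ℝ)} (hΩ : IsOpen Ω) {F : (Fin n → ℝ) → ℝ}
    (hF : ContDiffOn ℝ (⊤ : ℕ∞) F Ω) (v : Fin n → ℝ) :
    ContDiffOn ℝ (⊤ : ℕ∞) (dd v F) Ω := by
  have := hF.fderiv_of_isOpen (m := ((⊤ : ℕ∞) : WithTop ℕ∞)) hΩ (by simp)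
  exact this.clm_apply contDiffOn_const

lemma smooth_pd {n : ℕ} {Ω : Set (Fin n → ℝ)} (hΩ : IsOpen Ω) {F : (Fin n → ℝ) → ℝ}
    (hF : ContDiffOn ℝ (⊤ : ℕ∞) F Ω) (i : Fin n) :
    ContDiffOn ℝ (⊤ : ℕ∞) (pd i F) Ω := smooth_dd hΩ hF _

lemma smooth_differentiableAt {n : ℕ} {Ω : Set (Fin n → ℝ)} (hΩ : IsOpen Ω)
    {F : (Fin n → ℝ) → ℝ}
    (hF : ContDiffOn ℝ (⊤ : ℕ∞) F Ω) {x : Fin n → ℝ} (hx : x ∈ Ω) : DifferentiableAt ℝ F x :=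
  (hF.contDiffAt (hΩ.mem_nhds hx)).differentiableAt (by simp)

lemma hasDerivAt_line {n : ℕ} {Ω : Set (Fin n → ℝ)} (hΩ : IsOpen Ω) {F : (Fin n → ℝ) → ℝ}
    (hF : ContDiffOn ℝ (⊤ : ℕ∞) F Ω) (x v : Fin n → ℝ) (s : ℝ) (hx : x + s • v ∈ Ω) :
    HasDerivAt (fun s : ℝ => F (x + s • v)) (dd v F (x + s • v)) s := by
  have h1 := (smooth_differentiableAt hΩ hF hx).hasFDerivAt
  have h2 : HasDerivAt (fun s : ℝ => x + s • v) v s := by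
    simpa using ((hasDerivAt_id s).smul_const v).const_add x
  exact h1.comp_hasDerivAt s h2

lemma line_eventually {n : ℕ} {Ω : Set (Fin n → ℝ)} (hΩ : IsOpen Ω) {x : Fin n → ℝ} (hx : x ∈ Ω)
    (v : Fin n → ℝ) : ∀ᶠ s in 𝓝 (0:ℝ), x + s • v ∈ Ω := by
  have hc : Continuous (fun s : ℝ => x + s • v) := by fun_prop
  have : Tendsto (fun s : ℝ => x + s • v) (𝓝 0) (𝓝 x) := by
    simpa using hc.tendsto 0
  exact this.eventually (hΩ.mem_nhds hx)

lemma jet_line {n : ℕ} {Ω : Set (Fin n → ℝ)} (hΩ : IsOpen Ω) {F : (Fin n → ℝ) → ℝ}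
    (hF : ContDiffOn ℝ (⊤ : ℕ∞) F Ω) {x : Fin n → ℝ} (hx : x ∈ Ω) (v : Fin n → ℝ) :
    Jet (fun s : ℝ => F (x + s • v)) (F x) (dd v F x) (dd v (dd v F) x) := by
  refine ⟨by simp, fun s => dd v F (x + s • v), ?_, by simp, ?_⟩
  · filter_upwards [line_eventually hΩ hx v] with s hs using hasDerivAt_line hΩ hF x v s hs
  · have := hasDerivAt_line hΩ (smooth_dd hΩ hF v) x v 0 (by simpa using hx)
    simpa using this

lemma dd_comm {n : ℕ} {Ω : Set (Fin n → ℝ)} (hΩ : IsOpen Ω) {F : (Fin n → ℝ) → ℝ}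
    (hF : ContDiffOn ℝ (⊤ : ℕ∞) F Ω) {x : Fin n → ℝ} (hx : x ∈ Ω) (v w : Fin n → ℝ) :
    dd v (dd w F) x = dd w (dd v F) x := by
  have hs : IsSymmSndFDerivAt ℝ F x :=
    (hF.contDiffAt (hΩ.mem_nhds hx)).isSymmSndFDerivAt
      (by simp only [minSmoothness_of_isRCLikeNormedField]; exact WithTop.coe_le_coe.2 (le_top : (2 : ℕ∞) ≤ ⊤))
  have hd : DifferentiableAt ℝ (fderiv ℝ F) x :=
    ((hF.fderiv_of_isOpen (m := ((⊤ : ℕ∞) : WithTop ℕ∞)) hΩ (by simp)).contDiffAt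
      (hΩ.mem_nhds hx)).differentiableAt (by simp)
  have key : ∀ a b : Fin n → ℝ, dd a (dd b F) x = fderiv ℝ (fderiv ℝ F) x a b := by
    intro a b
    unfold dd
    rw [fderiv_clm_apply hd (differentiableAt_const b)]
    simp
  rw [key, key]; exact hs v w

/-- congruence on an open set. -/
lemma dd_congr {n : ℕ} {Ω : Set (Fin n → ℝ)} (hΩ : IsOpen Ω) {F G : (Fin n → ℝ) → ℝ}
    (h : ∀ y ∈ Ω, F y = G y) {x : Fin n → ℝ} (hx : x ∈ Ω) (v : Fin n → ℝ) :
    dd v F x = dd v G x := by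
  have : F =ᶠ[𝓝 x] G := by
    filter_upwards [hΩ.mem_nhds hx] with y hy using h y hy
  unfold dd; rw [this.fderiv_eq]

lemma dd_sum {n : ℕ} {Ω : Set (Fin n → ℝ)} (hΩ : IsOpen Ω) {ι : Type*} (s : Finset ι)
    (c : ι → ℝ) {F : ι → (Fin n → ℝ) → ℝ}
    (hF : ∀ i, ContDiffOn ℝ (⊤ : ℕ∞) (F i) Ω) {x : Fin n → ℝ} (hx : x ∈ Ω) (v : Fin n → ℝ) :
    dd v (fun y => ∑ i ∈ s, c i * F i y) x = ∑ i ∈ s, c i * dd v (F i) x := by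
  unfold dd
  rw [fderiv_fun_sum (fun i _ => ((smooth_differentiableAt hΩ (hF i) hx).const_mul (c i)))]
  rw [_root_.sum_apply]
  refine Finset.sum_congr rfl fun i _ => ?_
  rw [fderiv_const_mul (smooth_differentiableAt hΩ (hF i) hx)]
  simp


lemma hasDerivAt_det {n : ℕ} {m : ℝ → Matrix (Fin n) (Fin n) ℝ} {m' : Matrix (Fin n) (Fin n) ℝ}
    {t : ℝ} (h : ∀ i j, HasDerivAt (fun s => m s i j) (m' i j) t) :
    HasDerivAt (fun s => (m s).det) (∑ i, ∑ j, (m t).adjugate i j * m' j i) t := by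
  have h1 : HasDerivAt (fun s => (m s).det)
      (∑ σ : Equiv.Perm (Fin n), ((Equiv.Perm.sign σ : ℤ) : ℝ) *
        ∑ i, (∏ j ∈ Finset.univ.erase i, m t (σ j) j) * m' (σ i) i) t := by
    simp only [Matrix.det_apply']
    refine HasDerivAt.fun_sum fun σ _ => HasDerivAt.const_mul _ ?_
    have := HasDerivAt.fun_finsetProd (u := Finset.univ) (f := fun i s => m s (σ i) i)
      (f' := fun i => m' (σ i) i) (x := t) (fun i _ => h (σ i) i)
    simpa using this
  refine h1.congr_deriv ?_
  have h2 : ∀ i, ∑ j, (m t).adjugate i j * m' j i =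
      ((m t).updateCol i (fun j => m' j i)).det := by
    intro i
    rw [← Matrix.cramer_apply, Matrix.cramer_eq_adjugate_mulVec]
    rfl
  simp only [h2, Matrix.det_apply', Finset.mul_sum]
  rw [Finset.sum_comm]
  refine Finset.sum_congr rfl fun i _ => Finset.sum_congr rfl fun σ _ => ?_
  congr 1
  rw [← Finset.mul_prod_erase Finset.univ _ (Finset.mem_univ i)]
  simp only [Matrix.updateCol_self]
  rw [mul_comm]
  congr 1
  refine Finset.prod_congr rfl fun j hj => ?_
  rw [Matrix.updateCol_ne (Finset.ne_of_mem_erase hj)]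

lemma differentiableAt_adj {n : ℕ} {m : ℝ → Matrix (Fin n) (Fin n) ℝ}
    {m' : Matrix (Fin n) (Fin n) ℝ}
    {t : ℝ} (h : ∀ i j, HasDerivAt (fun s => m s i j) (m' i j) t) (i j : Fin n) :
    ∃ a, HasDerivAt (fun s => (m s).adjugate i j) a t := by
  simp only [Matrix.adjugate_apply]
  refine ⟨_, hasDerivAt_det (m := fun s => (m s).updateRow j (Pi.single i 1))
    (m' := m'.updateRow j 0) ?_⟩
  intro k l
  by_cases hk : k = j
  · subst hk
    simpa using hasDerivAt_const t _
  · simp only [Matrix.updateRow_ne hk]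
    exact h k l

lemma logdet_jet {n : ℕ} {m m1 : ℝ → Matrix (Fin n) (Fin n) ℝ} {m2 : Matrix (Fin n) (Fin n) ℝ}
    (h1 : ∀ᶠ s in 𝓝 (0:ℝ), ∀ i j, HasDerivAt (fun s => m s i j) (m1 s i j) s)
    (h2 : ∀ i j, HasDerivAt (fun s => m1 s i j) (m2 i j) 0) (h0 : m 0 = 1)
    {l : ℝ → ℝ} {c l0 l1 l2 : ℝ} (hl : Jet l l0 l1 l2)
    (hdet : ∀ᶠ s in 𝓝 (0:ℝ), (m s).det = c * Real.exp (l s)) :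
    ∑ i, m1 0 i i = l1 ∧ ∑ i, m2 i i - ∑ i, ∑ j, m1 0 i j * m1 0 j i = l2 := by
  obtain ⟨e0, l', hl', e1, e2⟩ := hl
  have hc : c * Real.exp l0 = 1 := by
    have := hdet.self_of_nhds
    rw [h0, e0, Matrix.det_one] at this
    exact this.symm
  have hfirst : ∀ᶠ s in 𝓝 (0:ℝ), ∑ i, ∑ j, (m s).adjugate i j * m1 s j i =
      c * (Real.exp (l s) * l' s) := by
    filter_upwards [h1, hl', hdet.eventually_nhds] with s a b hd
    have d1 := hasDerivAt_det a
    have d2 : HasDerivAt (fun s => c * Real.exp (l s)) (c * (Real.exp (l s) * l' s)) s :=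
      b.exp.const_mul c
    have d3 := d2.congr_of_eventuallyEq (f₁ := fun s => (m s).det) hd
    exact d1.unique d3
  have ha : (m 0).adjugate = 1 := by rw [h0]; exact Matrix.adjugate_one
  have t1 : ∑ i, m1 0 i i = l1 := by
    have := hfirst.self_of_nhds
    rw [ha, e0, e1, ← mul_assoc, hc, one_mul] at this
    rw [← this]
    refine Finset.sum_congr rfl fun i _ => ?_
    simp [Matrix.one_apply]
  refine ⟨t1, ?_⟩
  have h10 := h1.self_of_nhds
  choose b hb using fun i j => differentiableAt_adj h10 i j
  have hbv : ∀ i j, b i j = (if i = j then l1 else 0) - m1 0 i j := by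
    intro i j
    have d1 : HasDerivAt (fun s => ∑ k, (m s).adjugate i k * m s k j)
        (∑ k, (b i k * m 0 k j + (m 0).adjugate i k * m1 0 k j)) 0 :=
      HasDerivAt.fun_sum fun k _ => (hb i k).mul (h10 k j)
    have d2 : (fun s => ∑ k, (m s).adjugate i k * m s k j) =
        fun s => (m s).det * (if i = j then 1 else 0) := by
      funext s
      have := congrFun (congrFun (Matrix.adjugate_mul (m s)) i) j
      rw [Matrix.mul_apply] at this
      rw [this]
      simp [Matrix.one_apply]
    have d3 : HasDerivAt (fun s => (m s).det * (if i = j then (1:ℝ) else 0))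
        (l1 * (if i = j then 1 else 0)) 0 := by
      have := (hasDerivAt_det h10).mul_const (if i = j then (1:ℝ) else 0)
      refine this.congr_deriv ?_
      rw [← t1, ha]
      congr 1
      refine Finset.sum_congr rfl fun i _ => ?_
      simp [Matrix.one_apply]
    rw [d2] at d1
    have := d1.unique d3
    rw [ha, h0, Finset.sum_add_distrib] at this
    simp [Matrix.one_apply] at this
    split_ifs at this ⊢ <;> linarith
  have d1 : HasDerivAt (fun s => ∑ i, ∑ j, (m s).adjugate i j * m1 s j i)
      (∑ i, ∑ j, (b i j * m1 0 j i + (m 0).adjugate i j * m2 j i)) 0 :=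
    HasDerivAt.fun_sum fun i _ => HasDerivAt.fun_sum fun j _ => (hb i j).mul (h2 j i)
  have d2 : HasDerivAt (fun s => c * (Real.exp (l s) * l' s))
      (c * (Real.exp (l 0) * l' 0 * l' 0 + Real.exp (l 0) * l2)) 0 :=
    (hl'.self_of_nhds.exp.mul e2).const_mul c
  have := d1.unique (d2.congr_of_eventuallyEq hfirst)
  rw [ha, e0, e1] at this
  have hr : c * (Real.exp l0 * l1 * l1 + Real.exp l0 * l2) = l1 * l1 + l2 := by
    linear_combination (l1 * l1 + l2) * hc
  rw [hr] at this
  have hs : ∑ i, ∑ j, (b i j * m1 0 j i + (1 : Matrix (Fin n) (Fin n) ℝ) i j * m2 j i) =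
      l1 * ∑ i, m1 0 i i - ∑ i, ∑ j, m1 0 i j * m1 0 j i + ∑ i, m2 i i := by
    rw [Finset.mul_sum, ← Finset.sum_sub_distrib, ← Finset.sum_add_distrib]
    refine Finset.sum_congr rfl fun i _ => ?_
    simp only [hbv, sub_mul, Matrix.one_apply, ite_mul, zero_mul, one_mul]
    rw [Finset.sum_add_distrib, Finset.sum_sub_distrib]
    simp
  rw [hs, t1] at this
  linarith

lemma exists_frame {n : ℕ} {M : Matrix (Fin n) (Fin n) ℝ} (hM : M.PosDef) :
    ∃ A : Matrix (Fin n) (Fin n) ℝ, A.transpose * M * A = 1 ∧ A * A.transpose * M = 1 ∧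
      M * A * A.transpose = 1 := by
  open scoped MatrixOrder in
  have hnn : 0 ≤ M := Matrix.nonneg_iff_posSemidef.2 hM.posSemidef
  let S := CFC.sqrt M
  have hS : S * S = M := CFC.sqrt_mul_sqrt_self M hnn
  have hSt : S.transpose = S := by
    have : S.PosSemidef := Matrix.nonneg_iff_posSemidef.1 (CFC.sqrt_nonneg M)
    have h := this.isHermitian.eq
    rwa [Matrix.conjTranspose_eq_transpose_of_trivial] at h
  have hdet : IsUnit S.det := by
    rw [isUnit_iff_ne_zero]
    intro h
    have := hM.det_pos
    rw [← hS, Matrix.det_mul, h] at this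
    simp at this
  have hi1 := Matrix.nonsing_inv_mul S hdet
  have hi2 := Matrix.mul_nonsing_inv S hdet
  have hit : (S⁻¹).transpose = S⁻¹ := by rw [Matrix.transpose_nonsing_inv, hSt]
  refine ⟨S⁻¹, ?_, ?_, ?_⟩
  · rw [hit, ← hS, ← mul_assoc, hi1, one_mul, hi2]
  · rw [hit, ← hS, mul_assoc, ← mul_assoc S⁻¹ S S, hi1, one_mul, hi1]
  · rw [hit, ← hS, mul_assoc S S, hi2, mul_one, hi2]

lemma det_le_trace_pow {n : ℕ} {M : Matrix (Fin n) (Fin n) ℝ} (hM : M.PosDef) :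
    M.det ≤ M.trace ^ n := by
  have h1 := hM.isHermitian.det_eq_prod_eigenvalues
  have h2 := hM.isHermitian.trace_eq_sum_eigenvalues
  simp only [RCLike.ofReal_real_eq_id, id] at h1 h2
  rw [h1, h2]
  have h3 := hM.eigenvalues_pos
  calc ∏ i, hM.isHermitian.eigenvalues i
      ≤ ∏ i : Fin n, ∑ j, hM.isHermitian.eigenvalues j :=
        Finset.prod_le_prod (fun i _ => (h3 i).le) fun i _ =>
          Finset.single_le_sum (f := hM.isHermitian.eigenvalues)
            (fun j _ => (h3 j).le) (Finset.mem_univ i)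
    _ = _ := by simp


lemma dd_dd_eq {n : ℕ} {Ω : Set (Fin n → ℝ)} (hΩ : IsOpen Ω) {u : (Fin n → ℝ) → ℝ}
    (hu : ContDiffOn ℝ (⊤ : ℕ∞) u Ω) {x : Fin n → ℝ} (hx : x ∈ Ω) (a b : Fin n → ℝ) :
    dd a (dd b u) x = ∑ i, ∑ j, a i * hess u x i j * b j := by
  have h : dd b u = fun y => ∑ j, b j * pd j u y := funext fun y => dd_eq_sum b u y
  rw [h, dd_sum hΩ _ _ (fun j => smooth_pd hΩ hu j) hx, Finset.sum_comm]
  refine Finset.sum_congr rfl fun j _ => ?_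
  rw [dd_eq_sum, Finset.mul_sum]
  refine Finset.sum_congr rfl fun i _ => ?_
  simp only [hess, Matrix.of_apply]; ring

lemma frame_pkg {n : ℕ} {Ω : Set (Fin n → ℝ)} (hΩ : IsOpen Ω) {u : (Fin n → ℝ) → ℝ}
    (hu : ContDiffOn ℝ (⊤ : ℕ∞) u Ω) (hpos : ∀ x ∈ Ω, (hess u x).PosDef)
    {dv : Fin n → ℝ} {d0 : ℝ}
    (heq : ∀ ξ ∈ Ω, (hess u ξ).det = Real.exp (-(∑ i : Fin n, dv i * pd i u ξ) - d0))
    {x : Fin n → ℝ} (hx : x ∈ Ω) :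
    ∃ v : Fin n → Fin n → ℝ,
      (∀ a, dd (v a) (dd (v a) u) x = 1) ∧
      (∀ F z, dd z F x = ∑ a, dd (v a) (dd z u) x * dd (v a) F x) ∧
      (∑ k, ∑ a, (dd (v a) (pd k u) x) ^ 2 = (hess u x).trace) ∧
      (∀ z, ∑ a, dd (v a) (dd (v a) (dd z u)) x + dd dv (dd z u) x = 0) ∧
      (∑ a, dd (v a) (dd (v a) (dd dv (dd dv u))) x + dd dv (dd dv (dd dv u)) x =
        ∑ a, ∑ b, (dd dv (dd (v a) (dd (v b) u)) x) ^ 2) := by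
  obtain ⟨A, hA1, hA2, hA3⟩ := exists_frame (hpos x hx)
  let v : Fin n → Fin n → ℝ := fun a i => A i a
  have hm : ∀ y ∈ Ω, ∀ a b, dd (v a) (dd (v b) u) y = (A.transpose * hess u y * A) a b := by
    intro y hy a b
    rw [dd_dd_eq hΩ hu hy]
    simp only [Matrix.mul_apply, Matrix.transpose_apply, Finset.sum_mul, v]
    rw [Finset.sum_comm]
  have hsym : (hess u x).transpose = hess u x := by
    have h := (hpos x hx).isHermitian.eq
    rwa [Matrix.conjTranspose_eq_transpose_of_trivial] at h
  have hvz : ∀ a z, dd (v a) (dd z u) x = ∑ i, z i * (hess u x * A) i a := by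
    intro a z
    rw [dd_comm hΩ hu hx, dd_dd_eq hΩ hu hx]
    simp only [Matrix.mul_apply, Finset.mul_sum, v, mul_assoc]
  have hsm : ∀ a, ContDiffOn ℝ (⊤ : ℕ∞) (dd a u) Ω := fun a => smooth_dd hΩ hu a
  have hsm2 : ∀ a b, ContDiffOn ℝ (⊤ : ℕ∞) (dd a (dd b u)) Ω := fun a b => smooth_dd hΩ (hsm b) a
  have hlog : ∀ z, (∑ a, dd z (dd (v a) (dd (v a) u)) x = - dd z (dd dv u) x) ∧
      (∑ a, dd z (dd z (dd (v a) (dd (v a) u))) x -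
        ∑ a, ∑ b, dd z (dd (v a) (dd (v b) u)) x * dd z (dd (v b) (dd (v a) u)) x
        = - dd z (dd z (dd dv u)) x) := by
    intro z
    have jl : Jet (fun s : ℝ => (-1) * dd dv u (x + s • z) + (-d0))
        ((-1) * dd dv u x + (-d0)) ((-1) * dd z (dd dv u) x + 0)
        ((-1) * dd z (dd z (dd dv u)) x + 0) :=
      ((jet_line hΩ (hsm dv) hx z).smul (-1)).add (Jet.const (-d0))
    have := logdet_jet
      (m := fun s => Matrix.of fun a b => dd (v a) (dd (v b) u) (x + s • z))
      (m1 := fun s => Matrix.of fun a b => dd z (dd (v a) (dd (v b) u)) (x + s • z))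
      (m2 := Matrix.of fun a b => dd z (dd z (dd (v a) (dd (v b) u))) x)
      (c := A.det * A.det) ?_ ?_ ?_ jl ?_
    · simp only [Matrix.of_apply, zero_smul, add_zero] at this
      refine ⟨by linarith [this.1], by linarith [this.2]⟩
    · filter_upwards [line_eventually hΩ hx z] with s hs i j
      exact hasDerivAt_line hΩ (hsm2 _ _) x z s hs
    · intro i j
      have := hasDerivAt_line hΩ (smooth_dd hΩ (hsm2 (v i) (v j)) z) x z 0 (by simpa using hx)
      simpa using this
    · ext a b
      simp only [Matrix.of_apply, zero_smul, add_zero]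
      rw [hm x hx, hA1]
    · filter_upwards [line_eventually hΩ hx z] with s hs
      have e : (Matrix.of fun a b => dd (v a) (dd (v b) u) (x + s • z)) =
          A.transpose * hess u (x + s • z) * A := by
        ext a b
        rw [Matrix.of_apply, hm _ hs]
      rw [e, Matrix.det_mul, Matrix.det_mul, Matrix.det_transpose, heq _ hs, dd_eq_sum]
      have : -(∑ i, dv i * pd i u (x + s • z)) - d0 =
        -1 * ∑ i, dv i * pd i u (x + s • z) + -d0 := by ring
      rw [this]; ring
  refine ⟨v, ?_, ?_, ?_, ?_, ?_⟩
  · intro a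
    rw [hm x hx, hA1, Matrix.one_apply_eq]
  · intro F z
    have e1 : ∀ a, dd (v a) F x = ∑ j, A j a * pd j F x := fun a => dd_eq_sum _ _ _
    simp only [hvz, e1]
    rw [dd_eq_sum]
    have : ∀ i, pd i F x = ∑ a, (hess u x * A) i a * ∑ j, A j a * pd j F x := by
      intro i
      have h := congrFun (congrArg (fun N => Matrix.mulVec N (fun j => pd j F x)) hA3) i
      simp only [Matrix.one_mulVec] at h
      rw [← h, ← Matrix.mulVec_mulVec]
      simp [Matrix.mulVec, dotProduct]
    simp only [Finset.sum_mul]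
    rw [Finset.sum_comm]
    refine Finset.sum_congr rfl fun i _ => ?_
    conv_lhs => rw [this i, Finset.mul_sum]
    refine Finset.sum_congr rfl fun a _ => ?_
    ring
  · have e : ∀ k a, dd (v a) (pd k u) x = (hess u x * A) k a := by
      intro k a
      rw [pd_eq_dd, hvz]
      simp [Pi.single_apply]
    simp only [e]
    have : (hess u x) = (hess u x * A) * (hess u x * A).transpose := by
      rw [Matrix.transpose_mul, hsym, ← mul_assoc, hA3, one_mul]
    conv_rhs => rw [this]
    generalize hess u x * A = B
    simp [Matrix.trace, Matrix.mul_apply, sq]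
  · intro z
    have h := (hlog z).1
    have e : ∀ a, dd (v a) (dd (v a) (dd z u)) x = dd z (dd (v a) (dd (v a) u)) x := by
      intro a
      rw [dd_congr hΩ (fun y hy => dd_comm hΩ hu hy (v a) z) hx]
      exact dd_comm hΩ (hsm _) hx _ _
    rw [Finset.sum_congr rfl fun a _ => e a, h, dd_comm hΩ hu hx dv z]
    ring
  · have h := (hlog dv).2
    have e : ∀ a, dd (v a) (dd (v a) (dd dv (dd dv u))) x =
        dd dv (dd dv (dd (v a) (dd (v a) u))) x := by
      intro a
      have c1 : ∀ y ∈ Ω, dd (v a) (dd dv (dd dv u)) y = dd dv (dd dv (dd (v a) u)) y := by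
        intro y hy
        rw [dd_comm hΩ (hsm dv) hy]
        exact dd_congr hΩ (fun w hw => dd_comm hΩ hu hw _ _) hy _
      rw [dd_congr hΩ c1 hx, dd_comm hΩ (hsm2 _ _) hx]
      exact dd_congr hΩ (fun y hy => dd_comm hΩ (hsm _) hy _ _) hx _
    have e2 : ∀ a b, dd dv (dd (v b) (dd (v a) u)) x = dd dv (dd (v a) (dd (v b) u)) x :=
      fun a b => dd_congr hΩ (fun y hy => dd_comm hΩ hu hy _ _) hx _
    rw [Finset.sum_congr rfl fun a _ => e a]
    have e3 : ∑ a, ∑ b, (dd dv (dd (v a) (dd (v b) u)) x) ^ 2 =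
        ∑ a, ∑ b, dd dv (dd (v a) (dd (v b) u)) x * dd dv (dd (v b) (dd (v a) u)) x := by
      refine Finset.sum_congr rfl fun a _ => Finset.sum_congr rfl fun b _ => ?_
      rw [e2 a b, sq]
    rw [e3]; linarith


lemma T_ineq {n : ℕ} (hn : 2 ≤ n) (T : Fin n → Fin n → ℝ) (hT : ∀ a b, T a b = T b a)
    (δ p : Fin n → ℝ) (Q : ℝ) (hQ0 : 0 < Q) (hQ : ∑ a, δ a ^ 2 = Q) (htr : ∑ a, T a a = -Q)
    (hp : ∀ a, p a = ∑ b, T a b * δ b) :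
    (∑ a, (p a / Q + δ a) ^ 2) / ((n : ℝ) - 1) ≤
      (∑ a, ∑ b, T a b ^ 2) / Q - (∑ a, p a ^ 2) / Q ^ 2 := by
  have hnR : (2:ℝ) ≤ n := by exact_mod_cast hn
  set S1 := ∑ a, ∑ b, T a b ^ 2 with hS1
  set S2 := ∑ a, p a ^ 2 with hS2
  set τ := ∑ a, p a * δ a with hτ
  have hr : ∑ a, δ a * ∑ b, T a b * p b = S2 := by
    simp only [Finset.mul_sum]
    rw [Finset.sum_comm, hS2]
    refine Finset.sum_congr rfl fun b _ => ?_
    rw [sq]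
    nth_rewrite 3 [hp b]
    rw [Finset.mul_sum]
    refine Finset.sum_congr rfl fun a _ => ?_
    rw [hT a b]; ring
  have hN : ∑ a, ∑ b, (T a b + (-p a / Q + τ * δ a / Q ^ 2) * δ b + (-δ a / Q) * p b) ^ 2 =
      S1 - 2 * S2 / Q + τ ^ 2 / Q ^ 2 := by
    have row : ∀ a, ∑ b, (T a b + (-p a / Q + τ * δ a / Q ^ 2) * δ b + (-δ a / Q) * p b) ^ 2 =
        ∑ b, T a b ^ 2 + (-1 / Q) * p a ^ 2 + (2 * τ / Q ^ 2) * (p a * δ a) +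
          (S2 / Q ^ 2 - τ ^ 2 / Q ^ 3) * δ a ^ 2 + (-2 / Q) * (δ a * ∑ b, T a b * p b) := by
      intro a
      have h1 : ∀ x y : ℝ, ∑ b, (T a b + x * δ b + y * p b) ^ 2 =
          ∑ b, T a b ^ 2 + x ^ 2 * Q + y ^ 2 * S2 + 2 * x * p a
            + 2 * y * (∑ b, T a b * p b) + 2 * x * y * τ := by
        intro x y
        rw [← hQ, hS2, hp a, hτ]
        simp only [Finset.mul_sum, ← Finset.sum_add_distrib]
        refine Finset.sum_congr rfl fun b _ => ?_
        rw [hp b]; ring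
      rw [h1]
      field_simp
      ring
    rw [Finset.sum_congr rfl fun a _ => row a]
    simp only [Finset.sum_add_distrib, ← Finset.mul_sum]
    rw [← hS1, ← hS2, ← hτ, hQ, hr]
    field_simp
    ring
  have hJ : ∑ a : Fin n, ∑ b : Fin n, ((if a = b then (1:ℝ) else 0) - δ a * δ b / Q) ^ 2
      = n - 1 := by
    have row : ∀ a, ∑ b : Fin n, ((if a = b then (1:ℝ) else 0) - δ a * δ b / Q) ^ 2 =
        1 - δ a ^ 2 / Q := by
      intro a
      have h1 : ∀ b : Fin n, ((if a = b then (1:ℝ) else 0) - δ a * δ b / Q) ^ 2 =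
          (if a = b then 1 - 2 * (δ a * δ b / Q) else 0) + (δ a ^ 2 / Q ^ 2) * δ b ^ 2 := by
        intro b
        split_ifs <;> ring
      rw [Finset.sum_congr rfl fun b _ => h1 b, Finset.sum_add_distrib, ← Finset.mul_sum, hQ]
      simp
      field_simp
      ring
    rw [Finset.sum_congr rfl fun a _ => row a, Finset.sum_sub_distrib, ← Finset.sum_div, hQ]
    simp [hQ0.ne']
  have hNJ : ∑ a : Fin n, ∑ b : Fin n,
      (T a b + (-p a / Q + τ * δ a / Q ^ 2) * δ b + (-δ a / Q) * p b) *
        ((if a = b then (1:ℝ) else 0) - δ a * δ b / Q) = -Q - τ / Q := by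
    have row : ∀ a, ∑ b : Fin n,
      (T a b + (-p a / Q + τ * δ a / Q ^ 2) * δ b + (-δ a / Q) * p b) *
        ((if a = b then (1:ℝ) else 0) - δ a * δ b / Q) =
        T a a + (-2 / Q) * (p a * δ a) + (2 * τ / Q ^ 2 - τ / Q ^ 2) * δ a ^ 2 := by
      intro a
      have h1 : ∀ x y : ℝ, ∑ b : Fin n, (T a b + x * δ b + y * p b) *
        ((if a = b then (1:ℝ) else 0) - δ a * δ b / Q) =
          T a a + x * δ a + y * p a - δ a / Q * (p a + x * Q + y * τ) := by
        intro x y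
        have hrow : ∑ b, (T a b + x * δ b + y * p b) * δ b = p a + x * Q + y * τ := by
          have e : ∀ b, (T a b + x * δ b + y * p b) * δ b =
            T a b * δ b + x * δ b ^ 2 + y * (p b * δ b) := fun b => by ring
          rw [Finset.sum_congr rfl fun b _ => e b]
          simp only [Finset.sum_add_distrib, ← Finset.mul_sum]
          rw [hQ, ← hp a]
        have e : ∀ b, (T a b + x * δ b + y * p b) *
          ((if a = b then (1:ℝ) else 0) - δ a * δ b / Q) =
          (if a = b then T a b + x * δ b + y * p b else 0)
            - δ a / Q * ((T a b + x * δ b + y * p b) * δ b) := by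
          intro b
          split_ifs <;> ring
        rw [Finset.sum_congr rfl fun b _ => e b, Finset.sum_sub_distrib, ← Finset.mul_sum, hrow,
          Finset.sum_ite_eq]
        simp
      rw [h1]
      field_simp
      ring
    rw [Finset.sum_congr rfl fun a _ => row a]
    simp only [Finset.sum_add_distrib, ← Finset.mul_sum]
    rw [htr, ← hτ, hQ]
    field_simp
    ring
  have cs : (-Q - τ / Q) ^ 2 ≤ (S1 - 2 * S2 / Q + τ ^ 2 / Q ^ 2) * ((n:ℝ) - 1) := by
    rw [← hN, ← hJ, ← hNJ]
    simp only [← Finset.univ_product_univ, ← Finset.sum_product']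
    exact Finset.sum_mul_sq_le_sq_mul_sq _ _ _
  have cs2 : τ ^ 2 ≤ S2 * Q := by
    rw [hτ, hS2, ← hQ]
    exact Finset.sum_mul_sq_le_sq_mul_sq _ _ _
  have hS : ∑ a, (p a / Q + δ a) ^ 2 = S2 / Q ^ 2 + 2 * τ / Q + Q := by
    have e : ∀ a, (p a / Q + δ a) ^ 2 = (1 / Q ^ 2) * p a ^ 2 + (2 / Q) * (p a * δ a) + δ a ^ 2 :=
      fun a => by ring
    rw [Finset.sum_congr rfl fun b _ => e b]
    simp only [Finset.sum_add_distrib, ← Finset.mul_sum]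
    rw [hQ]
    ring
  rw [hS, div_le_iff₀ (by linarith)]
  have e1 : (-Q - τ / Q) ^ 2 = Q ^ 2 + 2 * τ + τ ^ 2 / Q ^ 2 := by field_simp; ring
  rw [e1] at cs
  have k0 : 0 ≤ S2 / Q - τ ^ 2 / Q ^ 2 := by
    rw [div_sub_div _ _ hQ0.ne' (by positivity)]
    apply div_nonneg _ (by positivity)
    nlinarith
  have k1 : S2 / Q + 2 * τ + Q ^ 2 ≤ (S1 - S2 / Q) * ((n:ℝ) - 1) := by
    have : 2 * S2 / Q = 2 * (S2 / Q) := by ring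
    rw [this] at cs
    nlinarith [mul_nonneg k0 (by linarith : (0:ℝ) ≤ (n:ℝ) - 2)]
  have e2 : S2 / Q ^ 2 + 2 * τ / Q + Q = (S2 / Q + 2 * τ + Q ^ 2) / Q := by field_simp
  have e3 : (S1 / Q - S2 / Q ^ 2) * ((n:ℝ) - 1) = (S1 - S2 / Q) * ((n:ℝ) - 1) / Q := by
    field_simp
  rw [e2, e3]
  gcongr


lemma alg2_scalar (n γ θ ε b y uf tr F U W D : ℝ) (hnR : 1 ≤ n)
    (hF0 : 0 ≤ F) (hU0 : 0 ≤ U) (hθ : 0 ≤ θ)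
    (i1 : D = -2 * n * γ * uf + ε * (2 * y * γ ^ 2 - 2 * y * γ ^ 3 * uf) - n * θ * U)
    (i2 : -2 * n * (n * γ - γ ^ 2 * F) + ε * (2 * γ ^ 2 * tr - 4 * γ ^ 3 * W
      + y * (6 * γ ^ 4 * F - 2 * n * γ ^ 3)) - n ^ 2 * θ - n * θ ^ 2 * U - n * θ * D ≤ 0)
    (hW : W ^ 2 ≤ 4 * y * tr * F)
    (hγ : 0 ≤ γ) (hyb : y * γ ^ 2 ≤ b) (hufγ : |uf| * γ ≤ 1) (hγθ : γ ≤ 2 * θ)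
    (hε : 0 ≤ ε) (hεb : ε * b ≤ 1 / 30) (htr : 0 ≤ tr) (hy : 0 ≤ y) :
    ε * (γ ^ 2 * tr) ≤ 9 * n ^ 2 * θ := by
  have hn0 : 0 ≤ n := by linarith
  have w1 : 4 * γ ^ 3 * W ≤ γ ^ 2 * tr + 16 * y * γ ^ 4 * F := by
    apply le_of_abs_le
    apply abs_le_of_sq_le_sq _ (by positivity)
    have e0 : (4 * γ ^ 3 * W) ^ 2 = 16 * γ ^ 6 * W ^ 2 := by ring
    have h1 : 16 * γ ^ 6 * W ^ 2 ≤ 16 * γ ^ 6 * (4 * y * tr * F) := by gcongr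
    have e1 : (γ ^ 2 * tr + 16 * y * γ ^ 4 * F) ^ 2 =
      (γ ^ 2 * tr - 16 * y * γ ^ 4 * F) ^ 2 + 16 * γ ^ 6 * (4 * y * tr * F) := by ring
    rw [e0, e1]
    linarith [sq_nonneg (γ ^ 2 * tr - 16 * y * γ ^ 4 * F)]
  have hεyγ : ε * (y * γ ^ 2) ≤ 1 / 30 := (mul_le_mul_of_nonneg_left hyb hε).trans hεb
  have hεyγ0 : 0 ≤ ε * (y * γ ^ 2) := by positivity
  have hgF : 0 ≤ γ ^ 2 * F := by positivity
  have w2 : 10 * (ε * (y * γ ^ 2)) * (γ ^ 2 * F) ≤ 1 * (γ ^ 2 * F) := by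
    apply mul_le_mul_of_nonneg_right _ hgF
    linarith
  have hnθ : 0 ≤ n * θ := by positivity
  have w3 : (ε * (y * γ ^ 2)) * (2 * n * γ) ≤ n * θ := by
    have : (ε * (y * γ ^ 2)) * (2 * n * γ) ≤ 1 / 30 * (2 * n * (2 * θ)) := by gcongr
    linarith
  obtain ⟨ua, ub⟩ := abs_le.1 (by rw [abs_mul, abs_of_nonneg hγ]; exact hufγ : |uf * γ| ≤ 1)
  have d1 : D ≤ 2 * n + 1 - n * θ * U := by
    rw [i1]
    have h1 : -2 * n * γ * uf = -(2 * n * (uf * γ)) := by ring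
    have h2 : ε * (2 * y * γ ^ 2 - 2 * y * γ ^ 3 * uf) =
      2 * (ε * (y * γ ^ 2) * (1 - uf * γ)) := by ring
    rw [h1, h2]
    have h3 : ε * (y * γ ^ 2) * (1 - uf * γ) ≤ 1 / 30 * 2 := by
      apply mul_le_mul hεyγ (by linarith) (by linarith) (by norm_num)
    have h4 : n * (-1) ≤ n * (uf * γ) := mul_le_mul_of_nonneg_left ua hn0
    linarith
  have d2 : n * θ * D ≤ n * θ * (2 * n + 1 - n * θ * U) :=
    mul_le_mul_of_nonneg_left d1 hnθ
  have hnn : n ≤ n ^ 2 := by nlinarith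
  have d3 : 0 ≤ (n ^ 2 - n) * (θ ^ 2 * U) := mul_nonneg (by linarith) (by positivity)
  have g1 : 2 * n ^ 2 * γ ≤ 2 * n ^ 2 * (2 * θ) := by gcongr
  have w1' := mul_le_mul_of_nonneg_left w1 hε
  have gF : 0 ≤ (2 * n - 1) * (γ ^ 2 * F) := mul_nonneg (by linarith) hgF
  have nn : n * θ ≤ n ^ 2 * θ := mul_le_mul_of_nonneg_right hnn hθ
  have k : ε * (γ ^ 2 * tr) ≤ 4 * n ^ 2 * θ + n * θ + n ^ 2 * θ + n * θ * (2 * n + 1) := by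
    ring_nf at i2 w1' w2 w3 d2 d3 g1 gF ⊢
    linarith
  have : n * θ * (2 * n + 1) = 2 * (n ^ 2 * θ) + n * θ := by ring
  linarith

lemma alg2 {n : ℕ} (hn : 1 ≤ n) (u f δ Laa faa Y Yaa : Fin n → ℝ)
    (γ θ ε b y uf tr : ℝ)
    (hp : ∀ a, -δ a - 2 * n * (γ * f a) + ε * (γ ^ 2 * Y a - 2 * y * γ ^ 3 * f a)
      - n * (θ * u a) = 0)
    (hq : ∀ a, Laa a - 2 * n * (γ * faa a - γ ^ 2 * f a ^ 2)
      + ε * (γ ^ 2 * Yaa a - 4 * γ ^ 3 * (Y a * f a) + y * (6 * γ ^ 4 * f a ^ 2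
        - 2 * γ ^ 3 * faa a)) - n * (θ + θ ^ 2 * u a ^ 2) ≤ 0)
    (hL : ∑ a, Laa a = ∑ a, δ a ^ 2)
    (hf : ∑ a, faa a + ∑ a, δ a * f a = n)
    (hY : ∑ a, Yaa a + ∑ a, δ a * Y a = 2 * tr)
    (huf : ∑ a, u a * f a = uf) (huY : ∑ a, u a * Y a = 2 * y)
    (hW : (∑ a, Y a * f a) ^ 2 ≤ 4 * y * tr * ∑ a, f a ^ 2)
    (hγ : 0 ≤ γ) (hyb : y * γ ^ 2 ≤ b) (hufγ : |uf| * γ ≤ 1) (hγθ : γ ≤ 2 * θ)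
    (hε : 0 ≤ ε) (hεb : ε * b ≤ 1 / 30) (htr : 0 ≤ tr) (hy : 0 ≤ y) :
    ε * (γ ^ 2 * tr) ≤ 9 * n ^ 2 * θ := by
  have hnR : (1:ℝ) ≤ n := by exact_mod_cast hn
  set F := ∑ a, f a ^ 2 with hF
  set U := ∑ a, u a ^ 2 with hU
  set W := ∑ a, Y a * f a with hWd
  set D := ∑ a, δ a * u a with hD
  have hF0 : 0 ≤ F := Finset.sum_nonneg fun _ _ => sq_nonneg _
  have hU0 : 0 ≤ U := Finset.sum_nonneg fun _ _ => sq_nonneg _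
  have hθ : 0 ≤ θ := by linarith
  have i1 : D = -2 * n * γ * uf + ε * (2 * y * γ ^ 2 - 2 * y * γ ^ 3 * uf) - n * θ * U := by
    have : ∑ a, u a * (-δ a - 2 * n * (γ * f a) + ε * (γ ^ 2 * Y a - 2 * y * γ ^ 3 * f a)
      - n * (θ * u a)) = 0 := Finset.sum_eq_zero fun a _ => by rw [hp a, mul_zero]
    have e : ∀ a, u a * (-δ a - 2 * n * (γ * f a) + ε * (γ ^ 2 * Y a - 2 * y * γ ^ 3 * f a)
      - n * (θ * u a)) = (-1) * (δ a * u a) + (-2 * n * γ - ε * 2 * y * γ ^ 3) * (u a * f a) +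
        (ε * γ ^ 2) * (u a * Y a) + (-n * θ) * u a ^ 2 := fun a => by ring
    rw [Finset.sum_congr rfl fun a _ => e a] at this
    simp only [Finset.sum_add_distrib, ← Finset.mul_sum] at this
    rw [huf, huY, ← hD, ← hU] at this
    linarith
  have i2 : -2 * n * (n * γ - γ ^ 2 * F) + ε * (2 * γ ^ 2 * tr - 4 * γ ^ 3 * W
      + y * (6 * γ ^ 4 * F - 2 * n * γ ^ 3)) - n ^ 2 * θ - n * θ ^ 2 * U - n * θ * D ≤ 0 := by
    have h0 : ∑ a, ((Laa a - 2 * n * (γ * faa a - γ ^ 2 * f a ^ 2)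
      + ε * (γ ^ 2 * Yaa a - 4 * γ ^ 3 * (Y a * f a) + y * (6 * γ ^ 4 * f a ^ 2
        - 2 * γ ^ 3 * faa a)) - n * (θ + θ ^ 2 * u a ^ 2)) +
        δ a * (-δ a - 2 * n * (γ * f a) + ε * (γ ^ 2 * Y a - 2 * y * γ ^ 3 * f a)
      - n * (θ * u a))) ≤ 0 := Finset.sum_nonpos fun a _ => by rw [hp a]; linarith [hq a]
    have e : ∀ a, ((Laa a - 2 * n * (γ * faa a - γ ^ 2 * f a ^ 2)
      + ε * (γ ^ 2 * Yaa a - 4 * γ ^ 3 * (Y a * f a) + y * (6 * γ ^ 4 * f a ^ 2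
        - 2 * γ ^ 3 * faa a)) - n * (θ + θ ^ 2 * u a ^ 2)) +
        δ a * (-δ a - 2 * n * (γ * f a) + ε * (γ ^ 2 * Y a - 2 * y * γ ^ 3 * f a)
      - n * (θ * u a))) =
        Laa a + (-1) * δ a ^ 2 + (-2 * n * γ - ε * y * 2 * γ ^ 3) * faa a
        + (-2 * n * γ - ε * y * 2 * γ ^ 3) * (δ a * f a)
        + (2 * n * γ ^ 2 + ε * y * 6 * γ ^ 4) * f a ^ 2
        + (ε * γ ^ 2) * Yaa a + (ε * γ ^ 2) * (δ a * Y a) + (-4 * ε * γ ^ 3) * (Y a * f a)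
        + (-n * θ) + (-n * θ ^ 2) * u a ^ 2 + (-n * θ) * (δ a * u a) := fun a => by ring
    rw [Finset.sum_congr rfl fun a _ => e a] at h0
    simp only [Finset.sum_add_distrib, ← Finset.mul_sum] at h0
    rw [hL, ← hF, ← hU, ← hWd, ← hD] at h0
    simp only [Finset.sum_const, Finset.card_univ, Fintype.card_fin, nsmul_eq_mul] at h0
    have hf' : ∑ a, faa a = n - ∑ a, δ a * f a := by linarith
    have hY' : ∑ a, Yaa a = 2 * tr - ∑ a, δ a * Y a := by linarith
    rw [hf', hY'] at h0
    ring_nf at h0 ⊢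
    linarith
  exact alg2_scalar n γ θ ε b y uf tr F U W D hnR hF0 hU0 hθ i1 i2 hW hγ hyb hufγ hγθ hε hεb
    htr hy


lemma sq_three (r s t : ℝ) : (r - s - t) ^ 2 ≤ 3 * (r ^ 2 + s ^ 2 + t ^ 2) := by
  nlinarith [sq_nonneg (r + s), sq_nonneg (r + t), sq_nonneg (s - t)]

lemma alg1_scalar (n γ θ β N B ν uf F U D V σ X G Z E : ℝ) (hn : 2 ≤ n)
    (hU0 : 0 ≤ U) (hθ : 0 ≤ θ) (hN0 : 0 < N) (hβ : 0 < β)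
    (hBd : B = β + 1) (hνB : ν ≤ 2 * B) (hν0 : 0 < ν)
    (i1 : B * D = V - 2 * n * β * (uf * γ) - N * θ * U)
    (hX0 : 0 ≤ X) (hσX : σ = ν * X) (hZ : Z = N ^ 2 * θ ^ 2 * U) 
    (hG : G = 2 * n * β * (γ ^ 2 * F))
    (i2 : E - 2 * n * β * (n * γ - γ ^ 2 * F)
      - N * n * θ - N * θ ^ 2 * U - N * θ * D ≤ 0)
    (hE : X ≤ E)
    (cs : V ^ 2 ≤ σ * U)
    (ua : -1 ≤ uf * γ) (ub : uf * γ ≤ 1) (hγθ : γ ≤ 2 * θ) (hN : 6 * B ≤ N) :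
    X / 4 + G + Z / (6 * B) ≤ (4 * n ^ 2 * β + 3 * n * N) * θ := by
  have hB1 : 1 < B := by linarith
  have hB0 : 0 < B := by linarith
  have hn0 : 0 < n := by linarith
  have hZ0 : 0 ≤ Z := by rw [hZ]; positivity
  set ζ := Z / B with hζ
  have hζ0 : 0 ≤ ζ := by positivity
  have hZζ : Z = B * ζ := by rw [hζ]; field_simp
  have c1 : N * θ * V / B ≤ 3 / 4 * X + 2 / 3 * ζ := by
    apply le_of_abs_le
    apply abs_le_of_sq_le_sq _ (by positivity)
    have e1 : (N * θ * V / B) ^ 2 = N ^ 2 * θ ^ 2 / B ^ 2 * V ^ 2 := by ring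
    have e2 : N ^ 2 * θ ^ 2 / B ^ 2 * V ^ 2 ≤ N ^ 2 * θ ^ 2 / B ^ 2 * (σ * U) := by gcongr
    have e3 : N ^ 2 * θ ^ 2 / B ^ 2 * (σ * U) = ν / B * (X * ζ) := by
      rw [hσX, hζ, hZ]; ring
    have e4 : ν / B ≤ 2 := by
      rw [div_le_iff₀ hB0]; linarith
    have e5 : ν / B * (X * ζ) ≤ 2 * (X * ζ) := by gcongr
    have e6 : (3 / 4 * X + 2 / 3 * ζ) ^ 2 =
      (3 / 4 * X - 2 / 3 * ζ) ^ 2 + 2 * (X * ζ) := by ring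
    rw [e1, e6]
    linarith [sq_nonneg (3 / 4 * X - 2 / 3 * ζ)]
  have c2 : N * θ * D = N * θ * V / B - 2 * n * N * θ * (β / B * (uf * γ)) - ζ := by
    have : D = (V - 2 * n * β * (uf * γ) - N * θ * U) / B := by
      rw [← i1]; field_simp
    rw [this, hζ, hZ]; ring
  have c3 : -(2 * n * N * θ * (β / B * (uf * γ))) ≤ 2 * n * N * θ := by
    have hb1 : β / B ≤ 1 := by rw [div_le_one (by linarith)]; linarith
    have hb0 : 0 ≤ β / B := by positivity
    have : β / B * (-1) ≤ β / B * (uf * γ) := mul_le_mul_of_nonneg_left ua hb0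
    have h3 : 0 ≤ 2 * n * N * θ := by positivity
    have := mul_le_mul_of_nonneg_left (by linarith : (-1:ℝ) ≤ β / B * (uf * γ)) h3
    linarith
  have c4 : N * θ ^ 2 * U ≤ ζ / 6 := by
    have h0 : 0 ≤ N * θ ^ 2 * U := by positivity
    have h1 := mul_le_mul_of_nonneg_left hN h0
    have h2 : N * θ ^ 2 * U * N = B * ζ := by rw [← hZζ, hZ]; ring
    rw [h2] at h1
    have h3 : B * (6 * (N * θ ^ 2 * U)) ≤ B * ζ := by linarith
    have := le_of_mul_le_mul_left h3 hB0
    linarith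
  have c5 : 2 * n * β * (n * γ) ≤ 4 * n ^ 2 * β * θ := by
    have : 2 * n * β * (n * γ) ≤ 2 * n * β * (n * (2 * θ)) := by gcongr
    linarith
  have c6 : Z / (6 * B) = ζ / 6 := by rw [hζ]; ring
  have c7 : 2 * n * β * (n * γ - γ ^ 2 * F) = 2 * n * β * (n * γ) - G := by rw [hG]; ring
  rw [c7] at i2
  rw [c6]
  linarith

set_option maxHeartbeats 1000000 in
lemma alg1 {n : ℕ} (hn : 2 ≤ n) (u f δ Laa faa P Qaa : Fin n → ℝ)
    (γ θ β N Q uf TT : ℝ)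
    (hp : ∀ a, P a / Q + β * (-δ a) - 2 * n * β * (γ * f a) - N * (θ * u a) = 0)
    (hq : ∀ a, Qaa a / Q - P a ^ 2 / Q ^ 2 + β * Laa a
      - 2 * n * β * (γ * faa a - γ ^ 2 * f a ^ 2) - N * (θ + θ ^ 2 * u a ^ 2) ≤ 0)
    (hL : ∑ a, Laa a = ∑ a, δ a ^ 2)
    (hf : ∑ a, faa a + ∑ a, δ a * f a = n)
    (hQaa : ∑ a, Qaa a + ∑ a, δ a * P a = TT)
    (hT : (∑ a, (P a / Q + δ a) ^ 2) / ((n : ℝ) - 1) ≤ TT / Q - (∑ a, P a ^ 2) / Q ^ 2)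
    (hQ : ∑ a, δ a ^ 2 = Q) (hQ0 : 0 < Q)
    (huf : ∑ a, u a * f a = uf)
    (hγ : 0 ≤ γ) (hufγ : |uf| * γ ≤ 1) (hγθ : γ ≤ 2 * θ)
    (hβ : 0 < β) (hB : (n - 1 : ℝ) / 2 ≤ β + 1) (hN : 6 * (β + 1) ≤ N) :
    (β + 1) ^ 2 * Q ≤ 3 * (4 * (n - 1) + 2 * n * β + 6 * (β + 1)) *
      ((4 * n ^ 2 * β + 3 * n * N) * θ) := by
  have hnR : (2:ℝ) ≤ n := by exact_mod_cast hn
  set F := ∑ a, f a ^ 2 with hF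
  set U := ∑ a, u a ^ 2 with hU
  set D := ∑ a, δ a * u a with hD
  set σ := ∑ a, (P a / Q + δ a) ^ 2 with hσ
  set V := ∑ a, (P a / Q + δ a) * u a with hV
  have hF0 : 0 ≤ F := Finset.sum_nonneg fun _ _ => sq_nonneg _
  have hU0 : 0 ≤ U := Finset.sum_nonneg fun _ _ => sq_nonneg _
  have hσ0 : 0 ≤ σ := Finset.sum_nonneg fun _ _ => sq_nonneg _
  have hθ : 0 ≤ θ := by linarith
  have hN0 : 0 < N := by linarith
  have hS : ∀ a, P a / Q + δ a = (β + 1) * δ a + 2 * n * β * (γ * f a) + N * (θ * u a) :=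
    fun a => by linarith [hp a]
  have i1 : (β + 1) * D = V - 2 * n * β * (uf * γ) - N * θ * U := by
    have : V = ∑ a, ((β + 1) * δ a + 2 * n * β * (γ * f a) + N * (θ * u a)) * u a := by
      rw [hV]; exact Finset.sum_congr rfl fun a _ => by rw [hS a]
    have e : ∀ a, ((β + 1) * δ a + 2 * n * β * (γ * f a) + N * (θ * u a)) * u a =
      (β + 1) * (δ a * u a) + (2 * n * β * γ) * (u a * f a) + (N * θ) * u a ^ 2 :=
      fun a => by ring
    rw [Finset.sum_congr rfl fun a _ => e a] at this
    simp only [Finset.sum_add_distrib, ← Finset.mul_sum] at this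
    rw [huf, ← hD, ← hU] at this
    linarith
  have i2 : TT / Q - (∑ a, P a ^ 2) / Q ^ 2 - 2 * n * β * (n * γ - γ ^ 2 * F)
      - N * n * θ - N * θ ^ 2 * U - N * θ * D ≤ 0 := by
    have h0 : ∑ a, ((Qaa a / Q - P a ^ 2 / Q ^ 2 + β * Laa a
      - 2 * n * β * (γ * faa a - γ ^ 2 * f a ^ 2) - N * (θ + θ ^ 2 * u a ^ 2)) +
        δ a * (P a / Q + β * (-δ a) - 2 * n * β * (γ * f a) - N * (θ * u a))) ≤ 0 :=
      Finset.sum_nonpos fun a _ => by rw [hp a]; linarith [hq a]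
    have e : ∀ a, ((Qaa a / Q - P a ^ 2 / Q ^ 2 + β * Laa a
      - 2 * n * β * (γ * faa a - γ ^ 2 * f a ^ 2) - N * (θ + θ ^ 2 * u a ^ 2)) +
        δ a * (P a / Q + β * (-δ a) - 2 * n * β * (γ * f a) - N * (θ * u a))) =
        (1 / Q) * Qaa a + (1 / Q) * (δ a * P a) + (-1 / Q ^ 2) * P a ^ 2 + β * Laa a +
        (-β) * δ a ^ 2 + (-2 * n * β * γ) * faa a + (-2 * n * β * γ) * (δ a * f a)
        + (2 * n * β * γ ^ 2) * f a ^ 2 + (-N * θ) + (-N * θ ^ 2) * u a ^ 2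
        + (-N * θ) * (δ a * u a) := fun a => by ring
    rw [Finset.sum_congr rfl fun a _ => e a] at h0
    simp only [Finset.sum_add_distrib, ← Finset.mul_sum] at h0
    rw [hL, ← hF, ← hU, ← hD] at h0
    simp only [Finset.sum_const, Finset.card_univ, Fintype.card_fin, nsmul_eq_mul] at h0
    have hf' : ∑ a, faa a = n - ∑ a, δ a * f a := by linarith
    have hY' : ∑ a, Qaa a = TT - ∑ a, δ a * P a := by linarith
    rw [hf', hY'] at h0
    have e2 : TT / Q = 1 / Q * TT := by ring
    have e3 : (∑ a, P a ^ 2) / Q ^ 2 = 1 / Q ^ 2 * ∑ a, P a ^ 2 := by ring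
    rw [e2, e3]
    ring_nf at h0 ⊢
    linarith
  obtain ⟨ua, ub⟩ := abs_le.1 (by rw [abs_mul, abs_of_nonneg hγ]; exact hufγ : |uf * γ| ≤ 1)
  have cs : V ^ 2 ≤ σ * U := by
    rw [hV, hσ, hU]; exact Finset.sum_mul_sq_le_sq_mul_sq _ _ _
  set B := β + 1 with hBd
  have hB1 : 1 < B := by linarith
  set ν : ℝ := (n:ℝ) - 1 with hν
  have hν0 : 0 < ν := by linarith
  obtain ⟨G, hG⟩ : ∃ G, G = 2 * n * β * (γ ^ 2 * F) := ⟨_, rfl⟩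
  obtain ⟨Z, hZ⟩ : ∃ Z, Z = N ^ 2 * θ ^ 2 * U := ⟨_, rfl⟩
  obtain ⟨X, hX⟩ : ∃ X, X = σ / ν := ⟨_, rfl⟩
  have hG0 : 0 ≤ G := by rw [hG]; positivity
  have hZ0 : 0 ≤ Z := by rw [hZ]; positivity
  have hX0 : 0 ≤ X := by rw [hX]; positivity
  have hσX : σ = ν * X := by rw [hX]; field_simp
  have main : X / 4 + G + Z / (6 * B) ≤ (4 * n ^ 2 * β + 3 * n * N) * θ :=
    alg1_scalar n γ θ β N B ν uf F U D V σ X G Z _ hnR hU0 hθ hN0 hβ hBd (by linarith) hν0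
      i1 hX0 hσX hZ hG i2 (by rw [hX]; exact hT) cs ua ub hγθ hN
  set R := (4 * n ^ 2 * β + 3 * n * N) * θ with hR
  have hR0 : 0 ≤ R := by positivity
  have hZB : 0 ≤ Z / (6 * B) := by positivity
  have b1 : σ ≤ 4 * ν * R := by rw [hσX]; nlinarith
  have b2 : G ≤ R := by linarith
  have b3 : Z ≤ 6 * B * R := by
    have : Z / (6 * B) ≤ R := by linarith
    rw [div_le_iff₀ (by positivity)] at this; linarith
  have fin : B ^ 2 * Q ≤ 3 * (σ + 2 * n * β * G + Z) := by
    have e0 : B ^ 2 * Q = ∑ a, (B * δ a) ^ 2 := by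
      rw [← hQ, Finset.mul_sum]; exact Finset.sum_congr rfl fun a _ => by ring
    have e1 : 3 * (σ + 2 * n * β * G + Z) = ∑ a, 3 * ((P a / Q + δ a) ^ 2 +
        (2 * n * β * (γ * f a)) ^ 2 + (N * (θ * u a)) ^ 2) := by
      rw [← Finset.mul_sum, Finset.sum_add_distrib, Finset.sum_add_distrib, hG, hZ, hF, hU]
      simp only [mul_pow, ← Finset.mul_sum]
      ring
    rw [e0, e1]
    refine Finset.sum_le_sum fun a _ => ?_
    have : B * δ a = (P a / Q + δ a) - 2 * n * β * (γ * f a) - N * (θ * u a) := by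
      rw [hS a]; ring
    rw [this]
    generalize P a / Q + δ a = r
    generalize 2 * n * β * (γ * f a) = s
    generalize N * (θ * u a) = t
    exact sq_three r s t
  have b2' : 2 * n * β * G ≤ 2 * n * β * R := by gcongr
  calc B ^ 2 * Q ≤ 3 * (σ + 2 * n * β * G + Z) := fin
    _ ≤ 3 * (4 * ν * R + 2 * n * β * R + 6 * B * R) := by gcongr
    _ = _ := by ring


lemma dd_dd_eq_sum {n : ℕ} {Ω : Set (Fin n → ℝ)} (hΩ : IsOpen Ω) {u : (Fin n → ℝ) → ℝ}
    (hu : ContDiffOn ℝ (⊤ : ℕ∞) u Ω) {x : Fin n → ℝ} (hx : x ∈ Ω) (v z : Fin n → ℝ) :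
    dd v (dd z u) x = ∑ i, z i * dd v (pd i u) x := by
  have h : dd z u = fun y => ∑ j, z j * pd j u y := funext fun y => dd_eq_sum z u y
  rw [h, dd_sum hΩ _ _ (fun j => smooth_pd hΩ hu j) hx]

lemma dd_dd_dd_eq_sum {n : ℕ} {Ω : Set (Fin n → ℝ)} (hΩ : IsOpen Ω) {u : (Fin n → ℝ) → ℝ}
    (hu : ContDiffOn ℝ (⊤ : ℕ∞) u Ω) {x : Fin n → ℝ} (hx : x ∈ Ω) (v z : Fin n → ℝ) :
    dd v (dd v (dd z u)) x = ∑ i, z i * dd v (dd v (pd i u)) x := by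
  rw [dd_congr hΩ (fun y hy => dd_dd_eq_sum hΩ hu hy v z) hx v,
    dd_sum hΩ _ _ (fun j => smooth_dd hΩ (smooth_pd hΩ hu j) v) hx]

lemma jet_coord {n : ℕ} (x v : Fin n → ℝ) (i : Fin n) :
    Jet (fun s : ℝ => (x + s • v) i) (x i) (v i) 0 := by
  refine ⟨by simp, fun _ => v i, Eventually.of_forall fun s => ?_, rfl, hasDerivAt_const _ _⟩
  have := ((hasDerivAt_id s).mul_const (v i)).const_add (x i)
  simpa using this

lemma jet_g {n : ℕ} {Ω : Set (Fin n → ℝ)} (hΩ : IsOpen Ω) {u : (Fin n → ℝ) → ℝ}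
    (hu : ContDiffOn ℝ (⊤ : ℕ∞) u Ω) {x : Fin n → ℝ} (hx : x ∈ Ω) (v : Fin n → ℝ) (d : ℝ) :
    Jet (fun s : ℝ => d + legendreF u (x + s • v)) (d + legendreF u x) (dd v (dd x u) x)
      (dd v (dd v u) x + dd v (dd v (dd x u)) x) := by
  have h1 := (Jet.const d).add ((Jet.sum Finset.univ (fun i _ =>
    (jet_coord x v i).mul (jet_line hΩ (smooth_pd hΩ hu i) hx v))).add
      ((jet_line hΩ hu hx v).smul (-1)))
  have e : (fun s : ℝ => d + legendreF u (x + s • v)) = fun s : ℝ => d +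
    (∑ i, (x + s • v) i * pd i u (x + s • v) + -1 * u (x + s • v)) := by
    funext s; unfold legendreF; ring
  rw [e]
  convert h1 using 1
  · unfold legendreF; ring
  · rw [dd_dd_eq_sum hΩ hu hx, Finset.sum_add_distrib, dd_eq_sum v u]; ring
  · simp only [zero_mul, zero_add, Finset.sum_add_distrib]
    rw [dd_dd_dd_eq_sum hΩ hu hx, dd_dd_eq_sum hΩ hu hx v v]
    simp only [mul_assoc, ← Finset.mul_sum]
    ring

lemma jet_y {n : ℕ} {Ω : Set (Fin n → ℝ)} (hΩ : IsOpen Ω) {u : (Fin n → ℝ) → ℝ}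
    (hu : ContDiffOn ℝ (⊤ : ℕ∞) u Ω) {x : Fin n → ℝ} (hx : x ∈ Ω) (v : Fin n → ℝ) :
    Jet (fun s : ℝ => ∑ k, (pd k u (x + s • v)) ^ 2) (∑ k, (pd k u x) ^ 2)
      (∑ k, 2 * pd k u x * dd v (pd k u) x)
      (∑ k, (2 * (dd v (pd k u) x) ^ 2 + 2 * pd k u x * dd v (dd v (pd k u)) x)) := by
  have h1 := Jet.sum Finset.univ (fun k _ =>
    (jet_line hΩ (smooth_pd hΩ hu k) hx v).mul (jet_line hΩ (smooth_pd hΩ hu k) hx v))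
  convert h1 using 1
  · funext s; exact Finset.sum_congr rfl fun k _ => by ring
  · exact Finset.sum_congr rfl fun k _ => by ring
  · exact Finset.sum_congr rfl fun k _ => by ring
  · exact Finset.sum_congr rfl fun k _ => by ring

lemma cs_W {n : ℕ} (x f : Fin n → ℝ) (m : Fin n → Fin n → ℝ) (tr : ℝ)
    (htr : ∑ k, ∑ a, (m k a) ^ 2 = tr) :
    (∑ a, (∑ k, 2 * x k * m k a) * f a) ^ 2 ≤ 4 * (∑ k, x k ^ 2) * tr * ∑ a, f a ^ 2 := by
  have e : ∑ a, (∑ k, 2 * x k * m k a) * f a = 2 * ∑ k, x k * (∑ a, m k a * f a) := by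
    simp only [Finset.sum_mul, Finset.mul_sum]
    rw [Finset.sum_comm]
    exact Finset.sum_congr rfl fun k _ => Finset.sum_congr rfl fun a _ => by ring
  rw [e]
  have h1 := Finset.sum_mul_sq_le_sq_mul_sq Finset.univ x (fun k => ∑ a, m k a * f a)
  have h2 : ∑ k, (∑ a, m k a * f a) ^ 2 ≤ tr * ∑ a, f a ^ 2 := by
    rw [← htr, Finset.sum_mul]
    exact Finset.sum_le_sum fun k _ => Finset.sum_mul_sq_le_sq_mul_sq _ _ _
  have h3 : 0 ≤ ∑ k, x k ^ 2 := Finset.sum_nonneg fun _ _ => sq_nonneg _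
  have h4 := mul_le_mul_of_nonneg_left h2 h3
  calc (2 * ∑ k, x k * (∑ a, m k a * f a)) ^ 2 = 4 * (∑ k, x k * (∑ a, m k a * f a)) ^ 2 := by ring
    _ ≤ 4 * ((∑ k, x k ^ 2) * (tr * ∑ a, f a ^ 2)) := by linarith
    _ = _ := by ring

lemma exists_max {n : ℕ} {Ω : Set (Fin n → ℝ)} {u E : (Fin n → ℝ) → ℝ} {C N : ℝ} (hN : 0 < N)
    (hC : 0 < C) (hu : ContinuousOn u Ω) (hK : IsCompact {ξ ∈ Ω | u ξ ≤ C})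
    {p : Fin n → ℝ} (hp : p ∈ Ω) (hup : u p = 0) (hE : ContinuousOn E {ξ ∈ Ω | u ξ ≤ C}) :
    ∃ x ∈ Ω, u x < C ∧ ∀ y ∈ Ω, u y < C →
      E y + N * Real.log (C - u y) ≤ E x + N * Real.log (C - u x) := by
  have hcu : ContinuousOn (fun y => (C - u y) ^ N * Real.exp (E y)) {ξ ∈ Ω | u ξ ≤ C} := by
    apply ContinuousOn.mul
    · apply ContinuousOn.rpow_const
      · exact continuousOn_const.sub (hu.mono fun y hy => hy.1)
      · intro y _; right; exact hN.le
    · exact hE.rexp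
  obtain ⟨x, hx, hmax⟩ := hK.exists_isMaxOn ⟨p, hp, by rw [hup]; exact hC.le⟩ hcu
  have hpx := hmax ⟨hp, by rw [hup]; exact hC.le⟩
  simp only [Set.mem_setOf_eq, hup, sub_zero] at hpx
  have hpos : 0 < (C - u x) ^ N * Real.exp (E x) := lt_of_lt_of_le (by positivity) hpx
  have hlt : u x < C := by
    refine lt_of_le_of_ne hx.2 fun h => ?_
    rw [h, sub_self, Real.zero_rpow hN.ne', zero_mul] at hpos
    exact lt_irrefl _ hpos
  refine ⟨x, hx.1, hlt, fun y hy hyC => ?_⟩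
  have h := hmax ⟨hy, hyC.le⟩
  simp only [Set.mem_setOf_eq] at h
  have h1 : 0 < C - u y := by linarith
  have h2 : 0 < C - u x := by linarith
  have h3 := Real.log_le_log (by positivity) h
  rw [Real.log_mul (by positivity) (by positivity), Real.log_mul (by positivity) (by positivity),
    Real.log_exp, Real.log_exp, Real.log_rpow h1, Real.log_rpow h2] at h3
  linarith

lemma line_max {n : ℕ} {Ω : Set (Fin n → ℝ)} (hΩ : IsOpen Ω) {u G : (Fin n → ℝ) → ℝ} {C : ℝ}
    (hu : ContinuousOn u Ω) {x : Fin n → ℝ} (hx : x ∈ Ω) (hxC : u x < C)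
    (h : ∀ y ∈ Ω, u y < C → G y ≤ G x) (v : Fin n → ℝ) :
    IsLocalMax (fun s : ℝ => G (x + s • v)) 0 := by
  have hc : Continuous (fun s : ℝ => x + s • v) := by fun_prop
  have ht : Tendsto (fun s : ℝ => x + s • v) (𝓝 0) (𝓝 x) := by
    simpa using hc.tendsto 0
  have h1 := ht.eventually (hΩ.mem_nhds hx)
  have h2 := ht.eventually ((hu.continuousAt (hΩ.mem_nhds hx)).eventually (gt_mem_nhds hxC))
  filter_upwards [h1, h2] with s hs1 hs2
  simpa using h _ hs1 hs2

structure Setup {n : ℕ} (b₁ C : ℝ) (Ω : Set (Fin n → ℝ)) (u : (Fin n → ℝ) → ℝ)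
    (dv : Fin n → ℝ) (d0 : ℝ) (p : Fin n → ℝ) (d : ℝ) : Prop where
  hn : 5 ≤ n
  hb₁ : 0 ≤ b₁
  hC0 : 0 < C
  hC1 : C ≤ 1
  hΩ : IsOpen Ω
  hu : ContDiffOn ℝ (⊤ : ℕ∞) u Ω
  hpos : ∀ x ∈ Ω, (hess u x).PosDef
  heq : ∀ ξ ∈ Ω, (hess u ξ).det = Real.exp (-(∑ i : Fin n, dv i * pd i u ξ) - d0)
  hnn : ∀ ξ ∈ Ω, 0 ≤ u ξ
  hp : p ∈ Ω
  hup : u p = 0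
  hK : IsCompact {ξ ∈ Ω | u ξ ≤ C}
  hd : 1 < d
  hb : ∀ ξ ∈ {ξ ∈ Ω | u ξ ≤ C},
    (∑ i : Fin n, (pd i u ξ) ^ 2) / (d + legendreF u ξ) ^ 2 ≤ b₁ ∧
      |u ξ + legendreF u ξ| ≤ d + legendreF u ξ

section
variable {n : ℕ} {b₁ C : ℝ} {Ω : Set (Fin n → ℝ)} {u : (Fin n → ℝ) → ℝ}
    {dv : Fin n → ℝ} {d0 : ℝ} {p : Fin n → ℝ} {d : ℝ}

lemma Setup.gpos (S : Setup b₁ C Ω u dv d0 p d) {x : Fin n → ℝ} (hx : x ∈ Ω) (hxC : u x ≤ C) :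
    0 < d + legendreF u x ∧ C - u x ≤ 2 * (d + legendreF u x) := by
  have h := (abs_le.1 (S.hb x ⟨hx, hxC⟩).2).1
  have := S.hd
  have := S.hC1
  constructor <;> linarith

lemma Setup.bounds (S : Setup b₁ C Ω u dv d0 p d) {x : Fin n → ℝ} (hx : x ∈ Ω) (hxC : u x < C) :
    (∑ i : Fin n, (pd i u x) ^ 2) * (d + legendreF u x)⁻¹ ^ 2 ≤ b₁ ∧
    |dd x u x| * (d + legendreF u x)⁻¹ ≤ 1 ∧
    (d + legendreF u x)⁻¹ ≤ 2 * (C - u x)⁻¹ := by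
  obtain ⟨h1, h2⟩ := S.gpos hx hxC.le
  obtain ⟨h3, h4⟩ := S.hb x ⟨hx, hxC.le⟩
  have hc : 0 < C - u x := by linarith
  refine ⟨?_, ?_, ?_⟩
  · rw [inv_pow, ← div_eq_mul_inv]; exact h3
  · rw [← div_eq_mul_inv, div_le_one h1, dd_eq_sum]
    have : ∑ i, x i * pd i u x = u x + legendreF u x := by unfold legendreF; ring
    rw [this]; exact h4
  · rw [← div_eq_mul_inv, inv_eq_one_div, div_le_div_iff₀ h1 hc]; linarith

lemma Setup.cont_g (S : Setup b₁ C Ω u dv d0 p d) :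
    ContinuousOn (fun y => d + legendreF u y) Ω := by
  unfold legendreF
  apply continuousOn_const.add
  apply ContinuousOn.sub _ S.hu.continuousOn
  apply continuousOn_finset_sum
  intro i _
  exact (continuous_apply i).continuousOn.mul (smooth_pd S.hΩ S.hu i).continuousOn

lemma Setup.cont_y (S : Setup b₁ C Ω u dv d0 p d) :
    ContinuousOn (fun y => ∑ i : Fin n, (pd i u y) ^ 2) Ω :=
  continuousOn_finset_sum _ fun i _ => (smooth_pd S.hΩ S.hu i).continuousOn.pow 2

end

section
variable {n : ℕ} {b₁ C : ℝ} {Ω : Set (Fin n → ℝ)} {u : (Fin n → ℝ) → ℝ}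
    {dv : Fin n → ℝ} {d0 : ℝ} {p : Fin n → ℝ} {d : ℝ}

lemma jet_Cu (hΩ : IsOpen Ω) (hu : ContDiffOn ℝ (⊤ : ℕ∞) u Ω) {x : Fin n → ℝ} (hx : x ∈ Ω)
    (v : Fin n → ℝ) (C : ℝ) :
    Jet (fun s : ℝ => C - u (x + s • v)) (C - u x) (-dd v u x) (-dd v (dd v u) x) := by
  have := (Jet.const C).add ((jet_line hΩ hu hx v).smul (-1))
  convert this using 1
  · funext s; ring
  · ring
  · ring
  · ring

lemma jet_L (hΩ : IsOpen Ω) (hu : ContDiffOn ℝ (⊤ : ℕ∞) u Ω) {x : Fin n → ℝ} (hx : x ∈ Ω)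
    (v dv : Fin n → ℝ) (d0 : ℝ) :
    Jet (fun s : ℝ => -dd dv u (x + s • v) - d0) (-dd dv u x - d0) (-dd v (dd dv u) x)
      (-dd v (dd v (dd dv u)) x) := by
  have := (Jet.const (-d0)).add ((jet_line hΩ (smooth_dd hΩ hu dv) hx v).smul (-1))
  convert this using 1
  · funext s; ring
  · ring
  · ring
  · ring

lemma Setup.log_det (S : Setup b₁ C Ω u dv d0 p d) {x : Fin n → ℝ} (hx : x ∈ Ω) :
    Real.log (hess u x).det = -dd dv u x - d0 := by
  rw [S.heq x hx, Real.log_exp, dd_eq_sum]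

lemma Setup.max2 (S : Setup b₁ C Ω u dv d0 p d) {ε : ℝ} (hε : 0 ≤ ε) (hεb : ε * b₁ ≤ 1 / 30)
    {x : Fin n → ℝ} (hx : x ∈ Ω) (hxC : u x < C)
    (hm : ∀ y ∈ Ω, u y < C →
      (-dd dv u y - d0) + -(2 * n) * Real.log (d + legendreF u y) +
        ε * ((∑ i, (pd i u y) ^ 2) * ((d + legendreF u y)⁻¹ * (d + legendreF u y)⁻¹))
        + n * Real.log (C - u y) ≤
      (-dd dv u x - d0) + -(2 * n) * Real.log (d + legendreF u x) +
        ε * ((∑ i, (pd i u x) ^ 2) * ((d + legendreF u x)⁻¹ * (d + legendreF u x)⁻¹))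
        + n * Real.log (C - u x)) :
    ε * ((d + legendreF u x)⁻¹ ^ 2 * (hess u x).trace) ≤ 9 * n ^ 2 * (C - u x)⁻¹ := by
  have hΩ := S.hΩ
  have hu := S.hu
  obtain ⟨v, v1, v2, v3, v4, v5⟩ := frame_pkg hΩ hu S.hpos S.heq hx
  obtain ⟨hyb, hufγ, hγθ⟩ := S.bounds hx hxC
  have hg := (S.gpos hx hxC.le).1
  have hc : 0 < C - u x := by linarith
  have hj : ∀ a, _ := fun a => ((((jet_L hΩ hu hx (v a) dv d0).add
    (((jet_g hΩ hu hx (v a) d).log hg).smul (-(2 * n)))).add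
      (((jet_y hΩ hu hx (v a)).mul (((jet_g hΩ hu hx (v a) d).inv hg).mul
        ((jet_g hΩ hu hx (v a) d).inv hg))).smul ε)).add
          (((jet_Cu hΩ hu hx (v a) C).log hc).smul n)).of_max
            (line_max hΩ hu.continuousOn hx hxC hm (v a))
  refine alg2 (n := n) (by have := S.hn; omega) (fun a => dd (v a) u x)
    (fun a => dd (v a) (dd x u) x)
    (fun a => dd (v a) (dd dv u) x) (fun a => -dd (v a) (dd (v a) (dd dv u)) x)
    (fun a => 1 + dd (v a) (dd (v a) (dd x u)) x)
    (fun a => ∑ k, 2 * pd k u x * dd (v a) (pd k u) x)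
    (fun a => ∑ k, (2 * (dd (v a) (pd k u) x) ^ 2 + 2 * pd k u x * dd (v a) (dd (v a) (pd k u)) x))
    (d + legendreF u x)⁻¹ (C - u x)⁻¹ ε b₁ (∑ i, (pd i u x) ^ 2) (dd x u x) (hess u x).trace
    ?_ ?_ ?_ ?_ ?_ ?_ ?_ ?_ (by positivity) hyb hufγ hγθ hε hεb ?_ ?_
  · intro a
    have h := (hj a).1
    rw [← h]
    simp only [div_eq_mul_inv, ← inv_pow]
    generalize (d + legendreF u x)⁻¹ = γ
    generalize (C - u x)⁻¹ = θ
    ring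
  · intro a
    have h := (hj a).2
    rw [v1 a] at h
    refine le_of_eq_of_le ?_ h
    simp only [div_eq_mul_inv, ← inv_pow]
    generalize (d + legendreF u x)⁻¹ = γ
    generalize (C - u x)⁻¹ = θ
    ring
  · rw [Finset.sum_neg_distrib]
    have h1 := v4 dv
    have h2 := v2 (dd dv u) dv
    simp only [sq]
    linarith
  · have h1 := v4 x
    have h2 := v2 (dd x u) dv
    rw [Finset.sum_add_distrib, ← h2]
    simp
    linarith
  · have hk : ∀ k, ∑ a, dd (v a) (dd (v a) (pd k u)) x +
        ∑ a, dd (v a) (dd dv u) x * dd (v a) (pd k u) x = 0 := by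
      intro k
      rw [← v2 (pd k u) dv]
      exact v4 (Pi.single k 1)
    rw [← v3]
    have e1 : ∑ a, ∑ k, (2 * (dd (v a) (pd k u) x) ^ 2
        + 2 * pd k u x * dd (v a) (dd (v a) (pd k u)) x) =
        ∑ k, (2 * ∑ a, (dd (v a) (pd k u) x) ^ 2 + 2 * pd k u x *
          ∑ a, dd (v a) (dd (v a) (pd k u)) x) := by
      rw [Finset.sum_comm]
      refine Finset.sum_congr rfl fun k _ => ?_
      rw [Finset.sum_add_distrib, Finset.mul_sum, Finset.mul_sum]
    have e2 : ∑ a, dd (v a) (dd dv u) x * ∑ k, 2 * pd k u x * dd (v a) (pd k u) x =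
        ∑ k, 2 * pd k u x * ∑ a, dd (v a) (dd dv u) x * dd (v a) (pd k u) x := by
      simp only [Finset.mul_sum]
      rw [Finset.sum_comm]
      exact Finset.sum_congr rfl fun k _ => Finset.sum_congr rfl fun a _ => by ring
    rw [e1, e2, ← Finset.sum_add_distrib, Finset.mul_sum]
    refine Finset.sum_congr rfl fun k _ => ?_
    linear_combination (2 * pd k u x) * hk k
  · rw [v2 u x]
    exact Finset.sum_congr rfl fun a _ => by ring
  · simp only [Finset.mul_sum]
    rw [Finset.sum_comm]
    refine Finset.sum_congr rfl fun k _ => ?_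
    have h := v2 u (Pi.single k 1)
    rw [← pd_eq_dd] at h
    have e : ∑ a, dd (v a) u x * (2 * pd k u x * dd (v a) (pd k u) x) =
        2 * pd k u x * ∑ a, dd (v a) (pd k u) x * dd (v a) u x := by
      rw [Finset.mul_sum]
      exact Finset.sum_congr rfl fun a _ => by ring
    rw [e, ← h]
    ring
  · exact cs_W (fun k => pd k u x) _ (fun k a => dd (v a) (pd k u) x) _ v3
  · exact (S.hpos x hx).posSemidef.trace_nonneg
  · exact Finset.sum_nonneg fun _ _ => sq_nonneg _

def cTwo (n : ℕ) (b₁ : ℝ) : ℝ := n * Real.log (270 * (1 + b₁) * n ^ 2) + 1 / 30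

lemma Setup.claim2 (S : Setup b₁ C Ω u dv d0 p d) {y : Fin n → ℝ} (hy : y ∈ Ω) (hyC : u y < C) :
    (-dd dv u y - d0) - 2 * n * Real.log (d + legendreF u y) + n * Real.log (C - u y)
      ≤ cTwo n b₁ := by
  have hb₁ := S.hb₁
  have hn := S.hn
  have hn0 : (0:ℝ) < n := by exact_mod_cast (by omega : 0 < n)
  set ε : ℝ := 1 / (30 * (1 + b₁)) with hεd
  have hε : 0 < ε := by positivity
  have hεb : ε * b₁ ≤ 1 / 30 := by
    rw [hεd, div_mul_eq_mul_div, div_le_div_iff₀ (by positivity) (by norm_num)]; linarith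
  have hgc := S.cont_g.mono (fun y (hy : y ∈ {ξ ∈ Ω | u ξ ≤ C}) => hy.1)
  have hyc := S.cont_y.mono (fun y (hy : y ∈ {ξ ∈ Ω | u ξ ≤ C}) => hy.1)
  have hLc := (smooth_dd S.hΩ S.hu dv).continuousOn.mono
    (fun y (hy : y ∈ {ξ ∈ Ω | u ξ ≤ C}) => hy.1)
  have hg0 : ∀ y ∈ {ξ ∈ Ω | u ξ ≤ C}, d + legendreF u y ≠ 0 :=
    fun y hy => (S.gpos hy.1 hy.2).1.ne'
  obtain ⟨x, hx, hxC, hm⟩ := exists_max (N := n) (E := fun y =>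
      (-dd dv u y - d0) + -(2 * n) * Real.log (d + legendreF u y) +
        ε * ((∑ i, (pd i u y) ^ 2) * ((d + legendreF u y)⁻¹ * (d + legendreF u y)⁻¹)))
    hn0 S.hC0 S.hu.continuousOn S.hK S.hp S.hup
    (((hLc.neg.sub continuousOn_const).add (continuousOn_const.mul (hgc.log hg0))).add
      (continuousOn_const.mul (hyc.mul ((hgc.inv₀ hg0).mul (hgc.inv₀ hg0)))))
  have key := S.max2 hε.le hεb hx hxC hm
  have h := hm y hy hyC
  obtain ⟨hyb, hufγ, hγθ⟩ := S.bounds hx hxC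
  have hg := (S.gpos hx hxC.le).1
  have hc : 0 < C - u x := by linarith
  have hLx := S.log_det hx
  have hdet := (S.hpos x hx).det_pos
  have htr0 := (S.hpos x hx).posSemidef.trace_nonneg
  have hdt := det_le_trace_pow (S.hpos x hx)
  have htr : 0 < (hess u x).trace := by
    refine lt_of_le_of_ne htr0 fun h => ?_
    rw [← h, zero_pow (by omega)] at hdt
    linarith
  have hL2 : Real.log (hess u x).det ≤ n * Real.log (hess u x).trace := by
    rw [← Real.log_pow]; exact Real.log_le_log hdet hdt
  have htb : (hess u x).trace ≤
      270 * (1 + b₁) * n ^ 2 * (d + legendreF u x) ^ 2 * (C - u x)⁻¹ := by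
    rw [hεd] at key
    generalize (hess u x).trace = t at *
    have e : (30 * (1 + b₁) * (d + legendreF u x) ^ 2) *
      (1 / (30 * (1 + b₁)) * ((d + legendreF u x)⁻¹ ^ 2 * t)) = t := by
      field_simp
    rw [← e]
    refine (mul_le_mul_of_nonneg_left key (by positivity)).trans_eq (by ring)
  have hlt := Real.log_le_log htr htb
  rw [Real.log_mul (by positivity) (by positivity), Real.log_mul (by positivity) (by positivity),
    Real.log_inv, Real.log_pow] at hlt
  have hlt2 := mul_le_mul_of_nonneg_left hlt hn0.le
  have hy1 : ε * ((∑ i, (pd i u x) ^ 2) * ((d + legendreF u x)⁻¹ * (d + legendreF u x)⁻¹))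
      ≤ 1 / 30 := by
    refine le_trans (mul_le_mul_of_nonneg_left ?_ hε.le) hεb
    rw [← sq]; exact hyb
  have hgy := (S.gpos hy hyC.le).1
  have hy2 : 0 ≤ ε * ((∑ i, (pd i u y) ^ 2) * ((d + legendreF u y)⁻¹ * (d + legendreF u y)⁻¹)) := by
    have : 0 ≤ ∑ i, (pd i u y) ^ 2 := Finset.sum_nonneg fun _ _ => sq_nonneg _
    positivity
  unfold cTwo
  push_cast at hlt2
  rw [hLx] at hL2
  linarith

end

section
variable {n : ℕ} {b₁ C : ℝ} {Ω : Set (Fin n → ℝ)} {u : (Fin n → ℝ) → ℝ}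
    {dv : Fin n → ℝ} {d0 : ℝ} {p : Fin n → ℝ} {d : ℝ}

lemma Setup.Q_eq (S : Setup b₁ C Ω u dv d0 p d) {x : Fin n → ℝ} (hx : x ∈ Ω) :
    dd dv (dd dv u) x = dotProduct dv ((hess u x).mulVec dv) := by
  rw [dd_dd_eq S.hΩ S.hu hx]
  simp only [dotProduct, Matrix.mulVec, Finset.mul_sum, mul_assoc]

lemma Setup.Q_pos (S : Setup b₁ C Ω u dv d0 p d) (hdv : dv ≠ 0) {x : Fin n → ℝ} (hx : x ∈ Ω) :
    0 < dd dv (dd dv u) x := by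
  rw [S.Q_eq hx]
  have := (S.hpos x hx).dotProduct_mulVec_pos hdv
  simpa using this

lemma Setup.max1 (S : Setup b₁ C Ω u dv d0 p d) (hdv : dv ≠ 0) {β N : ℝ}
    (hβ : 0 < β) (hB : (n - 1 : ℝ) / 2 ≤ β + 1) (hN : 6 * (β + 1) ≤ N)
    {x : Fin n → ℝ} (hx : x ∈ Ω) (hxC : u x < C)
    (hm : ∀ y ∈ Ω, u y < C →
      Real.log (dd dv (dd dv u) y) +
        β * ((-dd dv u y - d0) + -(2 * n) * Real.log (d + legendreF u y))
        + N * Real.log (C - u y) ≤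
      Real.log (dd dv (dd dv u) x) +
        β * ((-dd dv u x - d0) + -(2 * n) * Real.log (d + legendreF u x))
        + N * Real.log (C - u x)) :
    (β + 1) ^ 2 * dd dv (dd dv u) x ≤ 3 * (4 * (n - 1) + 2 * n * β + 6 * (β + 1)) *
      ((4 * n ^ 2 * β + 3 * n * N) * (C - u x)⁻¹) := by
  have hΩ := S.hΩ
  have hu := S.hu
  have hn2 : 2 ≤ n := by have := S.hn; omega
  obtain ⟨v, v1, v2, v3, v4, v5⟩ := frame_pkg hΩ hu S.hpos S.heq hx
  obtain ⟨hyb, hufγ, hγθ⟩ := S.bounds hx hxC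
  have hg := (S.gpos hx hxC.le).1
  have hc : 0 < C - u x := by linarith
  have hQ0 := S.Q_pos hdv hx
  have hs1 : ∀ z, ContDiffOn ℝ (⊤ : ℕ∞) (dd z u) Ω := fun z => smooth_dd hΩ hu z
  have hs2 : ∀ z w, ContDiffOn ℝ (⊤ : ℕ∞) (dd z (dd w u)) Ω := fun z w => smooth_dd hΩ (hs1 w) z
  have hc1 : ∀ a b c, dd a (dd b (dd c u)) x = dd b (dd a (dd c u)) x := fun a b c =>
    dd_comm hΩ (hs1 c) hx a b
  have hc2 : ∀ a b c, dd a (dd b (dd c u)) x = dd a (dd c (dd b u)) x := fun a b c =>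
    dd_congr hΩ (fun y hy => dd_comm hΩ hu hy b c) hx a
  have hQs : ∑ a, dd (v a) (dd dv u) x ^ 2 = dd dv (dd dv u) x := by
    rw [v2 (dd dv u) dv]; exact Finset.sum_congr rfl fun a _ => by ring
  have hT := T_ineq hn2 (fun a b => dd dv (dd (v a) (dd (v b) u)) x)
    (fun a b => hc2 _ _ _) (fun a => dd (v a) (dd dv u) x)
    (fun a => dd (v a) (dd dv (dd dv u)) x) (dd dv (dd dv u) x) hQ0 hQs
    (by
      have h := v4 dv
      have e : ∀ a, dd dv (dd (v a) (dd (v a) u)) x = dd (v a) (dd (v a) (dd dv u)) x := by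
        intro a; rw [hc1, hc2]
      rw [Finset.sum_congr rfl fun a _ => e a]
      linarith)
    (by
      intro a
      rw [hc1, hc2, v2 (dd dv (dd (v a) u)) dv]
      refine Finset.sum_congr rfl fun b _ => ?_
      rw [hc1 (v b) dv (v a), hc2 dv (v b) (v a)]
      ring)
  have hj : ∀ a, _ := fun a => (((((jet_line hΩ (hs2 dv dv) hx (v a)).log hQ0)).add
    (((jet_L hΩ hu hx (v a) dv d0).add
    (((jet_g hΩ hu hx (v a) d).log hg).smul (-(2 * n)))).smul β)).add
          (((jet_Cu hΩ hu hx (v a) C).log hc).smul N)).of_max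
            (line_max hΩ hu.continuousOn hx hxC hm (v a))
  refine alg1 (n := n) hn2 (fun a => dd (v a) u x)
    (fun a => dd (v a) (dd x u) x)
    (fun a => dd (v a) (dd dv u) x) (fun a => -dd (v a) (dd (v a) (dd dv u)) x)
    (fun a => 1 + dd (v a) (dd (v a) (dd x u)) x)
    (fun a => dd (v a) (dd dv (dd dv u)) x)
    (fun a => dd (v a) (dd (v a) (dd dv (dd dv u))) x)
    (d + legendreF u x)⁻¹ (C - u x)⁻¹ β N (dd dv (dd dv u) x) (dd x u x) _
    ?_ ?_ ?_ ?_ ?_ hT hQs hQ0 ?_ (by positivity) hufγ hγθ hβ hB hN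
  · intro a
    have h := (hj a).1
    rw [← h]
    simp only [div_eq_mul_inv, ← inv_pow]
    generalize (d + legendreF u x)⁻¹ = γ
    generalize (C - u x)⁻¹ = θ
    ring
  · intro a
    have h := (hj a).2
    rw [v1 a] at h
    refine le_of_eq_of_le ?_ h
    simp only [div_eq_mul_inv, ← inv_pow]
    generalize (d + legendreF u x)⁻¹ = γ
    generalize (C - u x)⁻¹ = θ
    ring
  · rw [Finset.sum_neg_distrib]
    have h1 := v4 dv
    linarith
  · have h1 := v4 x
    have h2 := v2 (dd x u) dv
    rw [Finset.sum_add_distrib, ← h2]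
    simp
    linarith
  · rw [← v2 (dd dv (dd dv u)) dv]
    exact v5
  · rw [v2 u x]
    exact Finset.sum_congr rfl fun a _ => by ring

def cThree (n : ℕ) (β N : ℝ) : ℝ :=
  3 * (4 * (n - 1) + 2 * n * β + 6 * (β + 1)) * (4 * n ^ 2 * β + 3 * n * N) / (β + 1) ^ 2

lemma Setup.claim1 (S : Setup b₁ C Ω u dv d0 p d) (hdv : dv ≠ 0) {β N : ℝ}
    (hβ : 0 < β) (hB : (n - 1 : ℝ) / 2 ≤ β + 1) (hN : 6 * (β + 1) ≤ N) (hN2 : n * β + 1 ≤ N)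
    {y : Fin n → ℝ} (hy : y ∈ Ω) (hyC : u y < C) :
    Real.log (dd dv (dd dv u) y) +
        β * ((-dd dv u y - d0) - 2 * n * Real.log (d + legendreF u y))
        + N * Real.log (C - u y) ≤ Real.log (cThree n β N) + β * cTwo n b₁ := by
  have hn := S.hn
  have hn1 : (5:ℝ) ≤ n := by exact_mod_cast hn
  have hgc := S.cont_g.mono (fun y (hy : y ∈ {ξ ∈ Ω | u ξ ≤ C}) => hy.1)
  have hLc := (smooth_dd S.hΩ S.hu dv).continuousOn.mono
    (fun y (hy : y ∈ {ξ ∈ Ω | u ξ ≤ C}) => hy.1)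
  have hQc := (smooth_dd S.hΩ (smooth_dd S.hΩ S.hu dv) dv).continuousOn.mono
    (fun y (hy : y ∈ {ξ ∈ Ω | u ξ ≤ C}) => hy.1)
  have hg0 : ∀ y ∈ {ξ ∈ Ω | u ξ ≤ C}, d + legendreF u y ≠ 0 :=
    fun y hy => (S.gpos hy.1 hy.2).1.ne'
  have hQ0 : ∀ y ∈ {ξ ∈ Ω | u ξ ≤ C}, dd dv (dd dv u) y ≠ 0 :=
    fun y hy => (S.Q_pos hdv hy.1).ne'
  obtain ⟨x, hx, hxC, hm⟩ := exists_max (N := N) (E := fun y =>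
      Real.log (dd dv (dd dv u) y) +
        β * ((-dd dv u y - d0) + -(2 * n) * Real.log (d + legendreF u y)))
    (by linarith) S.hC0 S.hu.continuousOn S.hK S.hp S.hup
    ((hQc.log hQ0).add (continuousOn_const.mul ((hLc.neg.sub continuousOn_const).add
      (continuousOn_const.mul (hgc.log hg0)))))
  have key := S.max1 hdv hβ hB hN hx hxC hm
  have h := hm y hy hyC
  have h2 := mul_le_mul_of_nonneg_left (S.claim2 hx hxC) hβ.le
  have hc : 0 < C - u x := by linarith
  have hQx := S.Q_pos hdv hx
  have hN0 : 0 < N := by linarith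
  have hn1' : (0:ℝ) < n - 1 := by linarith
  have hn0 : (0:ℝ) < n := by linarith
  have hc3 : 0 < cThree n β N := by unfold cThree; positivity
  have hQb : dd dv (dd dv u) x ≤ cThree n β N * (C - u x)⁻¹ := by
    have e : cThree n β N * (C - u x)⁻¹ = 3 * (4 * (n - 1) + 2 * n * β + 6 * (β + 1)) *
      ((4 * n ^ 2 * β + 3 * n * N) * (C - u x)⁻¹) / (β + 1) ^ 2 := by unfold cThree; ring
    rw [e, le_div_iff₀ (by positivity)]
    linarith
  have hlQ := Real.log_le_log hQx hQb
  rw [Real.log_mul hc3.ne' (by positivity), Real.log_inv] at hlQ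
  have hlc : Real.log (C - u x) ≤ 0 := Real.log_nonpos hc.le (by linarith [S.hnn x hx, S.hC1])
  have h4 : (N - 1 - n * β) * Real.log (C - u x) ≤ 0 :=
    mul_nonpos_of_nonneg_of_nonpos (by linarith) hlc
  linarith

lemma Setup.rho_eq (S : Setup b₁ C Ω u dv d0 p d) {x : Fin n → ℝ} (hx : x ∈ Ω) :
    rhoU u x = Real.exp ((-dd dv u x - d0) * (1 / ((n:ℝ) + 2))) := by
  unfold rhoU
  rw [S.heq x hx, ← Real.exp_mul, dd_eq_sum]

lemma Setup.pd_rho (S : Setup b₁ C Ω u dv d0 p d) {x : Fin n → ℝ} (hx : x ∈ Ω) (i : Fin n) :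
    pd i (rhoU u) x = rhoU u x * (-(1 / ((n:ℝ) + 2)) * (hess u x).mulVec dv i) := by
  rw [pd_eq_dd, dd_congr S.hΩ (fun y hy => S.rho_eq hy) hx, S.rho_eq hx]
  have hd : HasFDerivAt (dd dv u) (fderiv ℝ (dd dv u) x) x :=
    (smooth_differentiableAt S.hΩ (smooth_dd S.hΩ S.hu dv) hx).hasFDerivAt
  have h1 := (((hd.neg).sub_const d0).mul_const (1 / ((n:ℝ) + 2))).exp
  have h3 : dd (Pi.single i 1) (dd dv u) x = (hess u x).mulVec dv i := by
    rw [dd_dd_eq S.hΩ S.hu hx]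
    simp [Matrix.mulVec, dotProduct, Pi.single_apply]
  rw [← h3]
  have h4 : fderiv ℝ (fun y => Real.exp ((-dd dv u y - d0) * (1 / ((n:ℝ) + 2)))) x = _ :=
    h1.fderiv
  have h5 : dd (Pi.single i 1) (fun y => Real.exp ((-dd dv u y - d0) * (1 / ((n:ℝ) + 2)))) x =
    fderiv ℝ (fun y => Real.exp ((-dd dv u y - d0) * (1 / ((n:ℝ) + 2)))) x (Pi.single i 1) := rfl
  have h6 : dd (Pi.single i 1) (dd dv u) x = fderiv ℝ (dd dv u) x (Pi.single i 1) := rfl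
  rw [h5, h4, h6]
  simp

lemma Setup.Phi_eq (S : Setup b₁ C Ω u dv d0 p d) {x : Fin n → ℝ} (hx : x ∈ Ω) :
    PhiU u x = dd dv (dd dv u) x / ((n:ℝ) + 2) ^ 2 := by
  have hr : 0 < rhoU u x := by rw [S.rho_eq hx]; positivity
  have hdet : IsUnit (hess u x).det := (S.hpos x hx).det_pos.ne'.isUnit
  unfold PhiU
  simp only [S.pd_rho hx]
  rw [S.Q_eq hx]
  set w := (hess u x).mulVec dv with hw
  have e : ∑ i, ∑ j, (hess u x)⁻¹ i j * (rhoU u x * (-(1 / ((n:ℝ) + 2)) * w i)) *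
      (rhoU u x * (-(1 / ((n:ℝ) + 2)) * w j)) =
      (rhoU u x ^ 2 / ((n:ℝ) + 2) ^ 2) * dotProduct w ((hess u x)⁻¹.mulVec w) := by
    simp only [dotProduct, Matrix.mulVec, Finset.mul_sum]
    exact Finset.sum_congr rfl fun i _ => Finset.sum_congr rfl fun j _ => by field_simp
  rw [e]
  have e2 : (hess u x)⁻¹.mulVec w = dv := by
    rw [hw, Matrix.mulVec_mulVec, Matrix.nonsing_inv_mul _ hdet, Matrix.one_mulVec]
  rw [e2, dotProduct_comm w dv]
  field_simp

end

lemma neg_div_le_log {m N t : ℝ} (hm : 0 < m) (hN : 0 < N) (ht : 0 < t) :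
    -m / t ≤ N * Real.log t + N * Real.log (N / m) := by
  have h := Real.log_le_sub_one_of_pos (show 0 < m / (N * t) by positivity)
  rw [Real.log_div (by positivity) (by positivity), Real.log_mul (by positivity) (by positivity)]
    at h
  rw [Real.log_div (by positivity) (by positivity)]
  have h2 := mul_le_mul_of_nonneg_left h hN.le
  have e : N * (m / (N * t) - 1) = m / t - N := by field_simp
  rw [e] at h2
  rw [neg_div]
  linarith

/-- Lemma 6.1: with `α = (n+2)(n−3)/2 + (n−1)/4`, `m = 32(n+2)C`,
`h = m/(C−u)²`, `ε = 1/(30(1+b₁))` and `H = ε|∇u|²/(d+f)²`, there is a constant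
`d₁ > 0` depending only on `n`, `b₁` and `C` such that on `S_u(p,C)`:
`exp(−m/(C−u)) ρ^α Φ/(d+f)^{2nα/(n+2)} ≤ d₁` and
`exp(−m/(C−u)+H)(h+2α) ρ^α/(d+f)^{2nα/(n+2)} ≤ d₁`. -/
theorem lemma_6_1 (n : ℕ) (hn : 5 ≤ n) (b₁ : ℝ) (hb₁ : 0 ≤ b₁)
    (C : ℝ) (hC0 : 0 < C) (hC1 : C ≤ 1) :
    ∃ d₁ : ℝ, 0 < d₁ ∧
      ∀ (Ω : Set (Fin n → ℝ)), IsOpen Ω → Convex ℝ Ω →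
      ∀ (u : (Fin n → ℝ) → ℝ), ContDiffOn ℝ (⊤ : ℕ∞) u Ω →
        (∀ x ∈ Ω, (hess u x).PosDef) →
        ∀ (dv : Fin n → ℝ) (d0 : ℝ),
          (∀ ξ ∈ Ω,
            (hess u ξ).det = Real.exp (-(∑ i : Fin n, dv i * pd i u ξ) - d0)) →
          (∀ ξ ∈ Ω, 0 ≤ u ξ) →
          ∀ p ∈ Ω, u p = 0 →
          IsCompact {ξ ∈ Ω | u ξ ≤ C} →
          ∀ d : ℝ, 1 < d →
            (∀ ξ ∈ {ξ ∈ Ω | u ξ ≤ C},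
              (∑ i : Fin n, (pd i u ξ) ^ 2) / (d + legendreF u ξ) ^ 2 ≤ b₁ ∧
                |u ξ + legendreF u ξ| ≤ d + legendreF u ξ) →
            ∀ ξ ∈ Ω, u ξ < C →
              Real.exp (-(32 * ((n : ℝ) + 2) * C) / (C - u ξ)) *
                  (rhoU u ξ) ^ (alph n) * PhiU u ξ /
                  (d + legendreF u ξ) ^ (2 * (n : ℝ) * alph n / ((n : ℝ) + 2)) ≤ d₁ ∧
              Real.exp (-(32 * ((n : ℝ) + 2) * C) / (C - u ξ)
                    + (1 / (30 * (1 + b₁))) *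
                        (∑ i : Fin n, (pd i u ξ) ^ 2) / (d + legendreF u ξ) ^ 2) *
                  (32 * ((n : ℝ) + 2) * C / (C - u ξ) ^ 2 + 2 * alph n) *
                  (rhoU u ξ) ^ (alph n) /
                  (d + legendreF u ξ) ^ (2 * (n : ℝ) * alph n / ((n : ℝ) + 2)) ≤ d₁ := by
  obtain ⟨β, hβd⟩ : ∃ β : ℝ, β = alph n / ((n:ℝ) + 2) := ⟨_, rfl⟩
  have hn1 : (5:ℝ) ≤ n := by exact_mod_cast hn
  have hn0 : (0:ℝ) < n := by linarith
  have hα0 : 0 < alph n := by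
    have h1 : (0:ℝ) < (n:ℝ) - 3 := by linarith
    have h2 : (0:ℝ) < (n:ℝ) - 1 := by linarith
    unfold alph; positivity
  have hαβ : alph n = β * ((n:ℝ) + 2) := by rw [hβd]; field_simp
  have hβ : 0 < β := by rw [hβd]; positivity
  have hB : (n - 1 : ℝ) / 2 ≤ β + 1 := by
    have : ((n:ℝ) - 3) / 2 ≤ β := by
      rw [hβd, le_div_iff₀ (by positivity)]
      unfold alph; linarith
    linarith
  obtain ⟨N, hNd⟩ : ∃ N : ℝ, N = 6 * n * (β + 1) := ⟨_, rfl⟩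
  have hnb : 0 ≤ ((n:ℝ) - 1) * (β + 1) := mul_nonneg (by linarith) (by linarith)
  have hnb2 : 0 < n * β := by positivity
  have hN1 : 6 * (β + 1) ≤ N := by rw [hNd]; linarith
  have hN2 : n * β + 1 ≤ N := by rw [hNd]; linarith
  have hN0 : 0 < N := by linarith
  obtain ⟨m, hmd⟩ : ∃ m : ℝ, m = 32 * ((n:ℝ) + 2) * C := ⟨_, rfl⟩
  have hm0 : 0 < m := by rw [hmd]; positivity
  have hN'0 : 0 < 2 + n * β := by linarith
  rw [← hmd]
  refine ⟨Real.exp (N * Real.log (N / m) + (Real.log (cThree n β N) + β * cTwo n b₁)) / (n + 2) ^ 2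
    + (m + 2 * alph n) * Real.exp ((2 + n * β) * Real.log ((2 + n * β) / m) + 1 / 30
      + β * cTwo n b₁), by positivity, ?_⟩
  intro Ω hΩ _ u hu hpos dv d0 heq hnn p hp hup hK d hd hb ξ hξ hξC
  have S : Setup b₁ C Ω u dv d0 p d :=
    ⟨hn, hb₁, hC0, hC1, hΩ, hu, hpos, heq, hnn, hp, hup, hK, hd, hb⟩
  have hg := (S.gpos hξ hξC.le).1
  have ht : 0 < C - u ξ := by linarith
  have ht1 : C - u ξ ≤ 1 := by linarith [hnn ξ hξ]
  have hlt : Real.log (C - u ξ) ≤ 0 := Real.log_nonpos ht.le ht1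
  have c2 := mul_le_mul_of_nonneg_left (S.claim2 hξ hξC) hβ.le
  have hrho : rhoU u ξ ^ alph n = Real.exp (β * (-dd dv u ξ - d0)) := by
    rw [S.rho_eq hξ, ← Real.exp_mul, hαβ]
    congr 1
    field_simp
  have hgp : (d + legendreF u ξ) ^ (2 * (n : ℝ) * alph n / ((n : ℝ) + 2)) =
      Real.exp (2 * n * β * Real.log (d + legendreF u ξ)) := by
    rw [Real.rpow_def_of_pos hg, hαβ]
    congr 1
    field_simp
  rw [hrho, hgp]
  have hK1 : 0 < Real.exp (N * Real.log (N / m) + (Real.log (cThree n β N) + β * cTwo n b₁))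
    / ((n:ℝ) + 2) ^ 2 := by positivity
  have hK2 : 0 < (m + 2 * alph n) * Real.exp ((2 + n * β) * Real.log ((2 + n * β) / m) + 1 / 30
      + β * cTwo n b₁) := by positivity
  constructor
  · refine le_trans ?_ (le_add_of_nonneg_right hK2.le)
    rw [S.Phi_eq hξ]
    by_cases hdv : dv = 0
    · have : dd dv (dd dv u) ξ = 0 := by
        rw [S.Q_eq hξ, hdv]; simp
      rw [this]
      simp only [zero_div, mul_zero]
      exact hK1.le
    · have hQ := S.Q_pos hdv hξ
      have c1 := S.claim1 hdv hβ hB hN1 hN2 hξ hξC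
      have e : Real.exp (-m / (C - u ξ)) * Real.exp (β * (-dd dv u ξ - d0)) *
          (dd dv (dd dv u) ξ / ((n:ℝ) + 2) ^ 2) /
          Real.exp (2 * n * β * Real.log (d + legendreF u ξ)) =
          Real.exp (-m / (C - u ξ) + β * (-dd dv u ξ - d0) + Real.log (dd dv (dd dv u) ξ)
            - 2 * n * β * Real.log (d + legendreF u ξ)) / ((n:ℝ) + 2) ^ 2 := by
        rw [Real.exp_sub, Real.exp_add, Real.exp_add, Real.exp_log hQ]
        ring
      rw [e]
      apply div_le_div_of_nonneg_right _ (by positivity)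
      apply Real.exp_le_exp.2
      have := neg_div_le_log hm0 hN0 ht
      linarith
  · refine le_trans ?_ (le_add_of_nonneg_left hK1.le)
    have hH : (1 / (30 * (1 + b₁))) * (∑ i : Fin n, (pd i u ξ) ^ 2) / (d + legendreF u ξ) ^ 2
        ≤ 1 / 30 := by
      rw [mul_div_assoc]
      refine (mul_le_mul_of_nonneg_left (hb ξ ⟨hξ, hξC.le⟩).1 (by positivity)).trans ?_
      rw [div_mul_eq_mul_div, div_le_div_iff₀ (by positivity) (by norm_num)]; linarith
    generalize (1 / (30 * (1 + b₁))) * (∑ i : Fin n, (pd i u ξ) ^ 2) / (d + legendreF u ξ) ^ 2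
      = H at hH ⊢
    have hh : m / (C - u ξ) ^ 2 + 2 * alph n ≤
        (m + 2 * alph n) * Real.exp (-2 * Real.log (C - u ξ)) := by
      have e : Real.exp (-2 * Real.log (C - u ξ)) = 1 / (C - u ξ) ^ 2 := by
        have : -2 * Real.log (C - u ξ) = -(Real.log ((C - u ξ) ^ 2)) := by
          rw [Real.log_pow]; push_cast; ring
        rw [this, Real.exp_neg, Real.exp_log (by positivity), one_div]
      have h1 : 1 ≤ 1 / (C - u ξ) ^ 2 := by
        rw [le_div_iff₀ (by positivity), one_mul]
        exact pow_le_one₀ ht.le ht1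
      rw [e, add_mul]
      have h2 : m / (C - u ξ) ^ 2 = m * (1 / (C - u ξ) ^ 2) := by ring
      rw [h2]
      have h3 := mul_le_mul_of_nonneg_left h1 (by positivity : 0 ≤ 2 * alph n)
      linarith
    have e : Real.exp (-m / (C - u ξ) + H) *
        ((m + 2 * alph n) * Real.exp (-2 * Real.log (C - u ξ))) *
        Real.exp (β * (-dd dv u ξ - d0)) /
        Real.exp (2 * n * β * Real.log (d + legendreF u ξ)) =
        (m + 2 * alph n) * Real.exp ((-m / (C - u ξ) + H) + -2 * Real.log (C - u ξ) +
          β * (-dd dv u ξ - d0) - 2 * n * β * Real.log (d + legendreF u ξ)) := by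
      rw [Real.exp_sub _ (2 * n * β * Real.log (d + legendreF u ξ)), Real.exp_add _
        (β * (-dd dv u ξ - d0)), Real.exp_add _ (-2 * Real.log (C - u ξ))]
      ring
    calc _ ≤ Real.exp (-m / (C - u ξ) + H) *
        ((m + 2 * alph n) * Real.exp (-2 * Real.log (C - u ξ))) *
        Real.exp (β * (-dd dv u ξ - d0)) /
        Real.exp (2 * n * β * Real.log (d + legendreF u ξ)) := by gcongr
      _ = _ := e
      _ ≤ _ := by
        apply mul_le_mul_of_nonneg_left _ (by positivity)
        apply Real.exp_le_exp.2
        have := neg_div_le_log hm0 hN'0 ht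
        linarith
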